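/- arXiv:2309.01882 — 2 statements merged into one kernel-verified Lean document; each statement's English description precedes it below -/
import Mathlib

section
/- Let d ∈ ℕ, τ ≥ d+1, and n ≥ τ⁴. Let n̂ ∈ n S_d^o with p̂_n := n̂/n ∈ P_τ. Then for every p ∈ S_d^o, | Σ_{k : P_{n,p}(k) ≥ P_{n,p}(n̂)} P_{n,p}(k) − ∫_{{y : φ_{Σ_p}(δ_{y,p}) ≥ φ_{Σ_p}(δ_{n̂,p})}} n^{−d/2} φ_{Σ_p}(δ_{y,p}) dy | ≤ 194.96 τ³ (d+1) (log n)^{3/2} / n^{1/2}, where the sum is over k ∈ ℕ₀^d with ‖k‖₁ ≤ n. -/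
open MeasureTheory Matrix Real Finset
open scoped BigOperators ENNReal NNReal

noncomputable section

/-- Extended probability vector: `p` on `Fin d`, together with `p (d+1) = 1 - ∑ p`. -/
def extP (d : ℕ) (p : Fin d → ℝ) : Fin (d + 1) → ℝ :=
  Fin.snoc p (1 - ∑ i, p i)

/-- Extended coordinate vector: `v` on `Fin d`, together with `v (d+1) = n - ∑ v`. -/
def extV (d n : ℕ) (v : Fin d → ℝ) : Fin (d + 1) → ℝ :=
  Fin.snoc v ((n : ℝ) - ∑ i, v i)

/-- `δ_{y,q} = (y - n q) / √n`. -/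
def del (n : ℕ) (q y : ℝ) : ℝ := (y - n * q) / Real.sqrt n

/-- The vector `δ_{v,p}`. -/
def delVec (d n : ℕ) (p v : Fin d → ℝ) : Fin d → ℝ := fun i => del n (p i) (v i)

/-- The covariance matrix `Σ_p = diag p - p pᵀ`. -/
def covM (d : ℕ) (p : Fin d → ℝ) : Matrix (Fin d) (Fin d) ℝ :=
  Matrix.diagonal p - Matrix.vecMulVec p p

/-- The quadratic form `x ↦ xᵀ Σ_p⁻¹ x`. -/
def quadForm (d : ℕ) (p x : Fin d → ℝ) : ℝ := x ⬝ᵥ ((covM d p)⁻¹ *ᵥ x)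

/-- The Gaussian density `φ_{Σ_p}`. -/
def gaussDens (d : ℕ) (p y : Fin d → ℝ) : ℝ :=
  Real.exp (-(1 / 2) * quadForm d p y) /
    Real.sqrt ((2 * Real.pi) ^ d * ∏ i, extP d p i)

/-- The `Multinomial(n, p)` probability mass function. -/
def multinomialPMF (d n : ℕ) (p : Fin d → ℝ) (k : Fin d → ℕ) : ℝ :=
  if ∑ i, k i ≤ n then
    ((n.factorial : ℝ) / ((∏ i, ((k i).factorial : ℝ)) * ((n - ∑ i, k i).factorial : ℝ))) *
      ((∏ i, p i ^ k i) * (1 - ∑ i, p i) ^ (n - ∑ i, k i))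
  else 0

/-- The interior `S_d^o` of the unit simplex. -/
def simplexInt (d : ℕ) : Set (Fin d → ℝ) :=
  {s | (∀ i, s i ∈ Set.Ioo (0 : ℝ) 1) ∧ ∑ i, s i < 1}

/-- The set `P_τ`. -/
def Ptau (d : ℕ) (τ : ℝ) : Set (Fin d → ℝ) :=
  {s | s ∈ simplexInt d ∧ ∀ i : Fin (d + 1), (extP d s i)⁻¹ ≤ τ}

/-- Cast a vector of naturals to a real vector. -/
def castK (d : ℕ) (k : Fin d → ℕ) : Fin d → ℝ := fun i => (k i : ℝ)

/-- The bulk set `B_{n,p}` (integer vectors). -/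
def bulk (d n : ℕ) (τ : ℝ) (p : Fin d → ℝ) : Set (Fin d → ℕ) :=
  {k | (∀ i, 0 < k i) ∧ ∑ i, k i < n ∧
    ∀ i : Fin (d + 1),
      |del n (extP d p i) (extV d n (castK d k) i) / (Real.sqrt n * extP d p i)| ≤
        τ * Real.sqrt (Real.log n / n)}

/-- The bulk set `B_{n,p}` (real vectors). -/
def bulkReal (d n : ℕ) (τ : ℝ) (p : Fin d → ℝ) : Set (Fin d → ℝ) :=
  {x | ∀ i : Fin (d + 1),
    |del n (extP d p i) (extV d n x i) / (Real.sqrt n * extP d p i)| ≤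
      τ * Real.sqrt (Real.log n / n)}

/-- The main term in the local expansion. -/
def mainTerm (d n : ℕ) (p v : Fin d → ℝ) : ℝ :=
  (n : ℝ) ^ (-(1 : ℝ) / 2) * ∑ i : Fin (d + 1),
    (del n (extP d p i) (extV d n v i) ^ 3 / (6 * extP d p i ^ 2) -
      del n (extP d p i) (extV d n v i) / (2 * extP d p i))

/-- The bound on the remainder `R_{n,p}(k)`. -/
def errBound (d n : ℕ) (τ : ℝ) (p v : Fin d → ℝ) : ℝ :=
  (n : ℝ)⁻¹ * ∑ i : Fin (d + 1),
    (21 * |del n (extP d p i) (extV d n v i)| ^ 4 / extP d p i ^ 3 +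
      10 * |del n (extP d p i) (extV d n v i)| ^ 2 / extP d p i ^ 2 + 2 * τ / 3)

/-- The log-ratio of the multinomial pmf over the corresponding normal density. -/
def logRatio (d n : ℕ) (p : Fin d → ℝ) (k : Fin d → ℕ) : ℝ :=
  Real.log (multinomialPMF d n p k /
    ((n : ℝ) ^ (-(d : ℝ) / 2) * gaussDens d p (delVec d n p (castK d k))))

/-- The law of a `Multinomial(n,p)` random vector, as a measure on `ℝ^d`. -/
def multinomialLaw (d n : ℕ) (p : Fin d → ℝ) : Measure (Fin d → ℝ) :=
  Measure.sum fun k : Fin d → ℕ =>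
    ENNReal.ofReal (multinomialPMF d n p k) • Measure.dirac (castK d k)

/-- The law of a `Uniform(-1/2,1/2)^d` random vector. -/
def uniformBoxLaw (d : ℕ) : Measure (Fin d → ℝ) :=
  volume.restrict (Set.univ.pi fun _ : Fin d => Set.Ioo (-(1 : ℝ) / 2) (1 / 2))

/-- The law of a `Normal_d (n p, n Σ_p)` random vector. -/
def gaussLaw (d n : ℕ) (p : Fin d → ℝ) : Measure (Fin d → ℝ) :=
  volume.withDensity fun y =>
    ENNReal.ofReal ((n : ℝ) ^ (-(d : ℝ) / 2) * gaussDens d p (delVec d n p y))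

/-- The regularized lower incomplete gamma function `γ̄(x, a)`. -/
def regGamma (x a : ℝ) : ℝ :=
  (∫ t in (0 : ℝ)..a, t ^ (x - 1) * Real.exp (-t)) / Real.Gamma x

/-- The sum `∑_{k : P_{n,p}(k) ≥ P_{n,p}(n̂)} P_{n,p}(k)`. -/
def confSum (d n : ℕ) (p : Fin d → ℝ) (nh : Fin d → ℕ) : ℝ :=
  ∑' k : Fin d → ℕ,
    Set.indicator {k' : Fin d → ℕ | multinomialPMF d n p nh ≤ multinomialPMF d n p k'}
      (multinomialPMF d n p) k

/-- The exact multinomial confidence set `C(p̂_n, α)`. -/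
def exactCS (d n : ℕ) (nh : Fin d → ℕ) (α : ℝ) : Set (Fin d → ℝ) :=
  {p | p ∈ simplexInt d ∧ confSum d n p nh ≤ 1 - α}

/-- The Gaussian confidence set `C̃(p̂_n, α)`. -/
def gaussCS (d n : ℕ) (nh : Fin d → ℕ) (α : ℝ) : Set (Fin d → ℝ) :=
  {p | p ∈ simplexInt d ∧
    regGamma ((d : ℝ) / 2) (quadForm d p (delVec d n p (castK d nh)) / 2) ≤ 1 - α}

lemma log_stirlingSeq_le (n : ℕ) (hn : n ≠ 0) :
    Real.log (Stirling.stirlingSeq n) ≤ Real.log √π + 1 / (12 * n) := by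
  have hstep : Monotone fun k : ℕ =>
      Real.log (Stirling.stirlingSeq (k + 1)) - 1 / (12 * ((k : ℝ) + 1)) := by
    refine monotone_nat_of_le_succ fun k => ?_
    have h := Stirling.log_stirlingSeq_sdiff_le (k + 1)
    push_cast at h ⊢
    have e : 1 / (12 * ((k : ℝ) + 1) * (k + 1 + 1)) =
        1 / (12 * ((k : ℝ) + 1)) - 1 / (12 * ((k : ℝ) + 1 + 1)) := by field_simp; ring
    rw [e] at h
    linarith
  have hlim : Filter.Tendsto (fun k : ℕ =>
      Real.log (Stirling.stirlingSeq (k + 1)) - 1 / (12 * ((k : ℝ) + 1)))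
      Filter.atTop (nhds (Real.log √π - 1 / 12 * 0)) := by
    refine Filter.Tendsto.sub ?_ ?_
    · exact ((Filter.tendsto_add_atTop_iff_nat 1).2 Stirling.tendsto_stirlingSeq_sqrt_pi).log
        (by positivity)
    · have := (tendsto_one_div_add_atTop_nhds_zero_nat (𝕜 := ℝ)).const_mul (1 / 12 : ℝ)
      refine this.congr fun k => ?_
      rw [div_mul_div_comm, one_mul]
  have := hstep.ge_of_tendsto hlim (n - 1)
  obtain ⟨m, rfl⟩ := Nat.exists_eq_succ_of_ne_zero hn
  simp only [Nat.succ_eq_add_one, Nat.add_sub_cancel] at this ⊢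
  push_cast
  linarith

/-- The error in Stirling's approximation of `log n!`. -/
def stirlingErr (n : ℕ) : ℝ :=
  Real.log n.factorial - (n * Real.log n - n + 1 / 2 * Real.log (2 * π * n))

lemma stirlingErr_nonneg {n : ℕ} (hn : n ≠ 0) : 0 ≤ stirlingErr n := by
  have h := Stirling.le_log_factorial_stirling hn
  have hn' : (0 : ℝ) < n := by positivity
  rw [stirlingErr, Real.log_mul (by positivity) hn'.ne']

  linarith

lemma stirlingErr_le {n : ℕ} (hn : n ≠ 0) : stirlingErr n ≤ 1 / (12 * n) := by
  have h := log_stirlingSeq_le n hn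
  have hn' : (0 : ℝ) < n := by positivity
  rw [Stirling.log_stirlingSeq_formula, Real.log_div hn'.ne' (Real.exp_pos 1).ne', Real.log_exp,
    Real.log_sqrt pi_pos.le, Real.log_mul two_ne_zero hn'.ne'] at h
  rw [stirlingErr, Real.log_mul (by positivity) hn'.ne', Real.log_mul two_ne_zero pi_pos.ne']
  linarith

lemma abs_log_one_add_le {x : ℝ} (hx : |x| ≤ 1 / 2) : |Real.log (1 + x)| ≤ 2 * |x| := by
  have h := Real.abs_log_sub_add_sum_range_le (x := -x) (by rw [abs_neg]; linarith) 0
  simp only [range_zero, sum_empty, zero_add, sub_neg_eq_add, abs_neg, pow_one] at h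
  refine h.trans ?_
  rw [div_le_iff₀ (by linarith)]
  nlinarith [abs_nonneg x]

lemma abs_entropy_sub_le {x : ℝ} (hx : |x| ≤ 1 / 4) :
    |(1 + x) * Real.log (1 + x) - x - x ^ 2 / 2| ≤ |x| ^ 3 := by
  have h := Real.abs_log_sub_add_sum_range_le (x := -x) (by rw [abs_neg]; linarith) 3
  simp only [sum_range_succ, range_zero, sum_empty, zero_add, sub_neg_eq_add, abs_neg] at h
  norm_num at h
  set E := -x + x ^ 2 / 2 + (-x) ^ 3 / 3 + Real.log (1 + x) with hE
  have hE' : |E| ≤ |x| ^ 3 * (1 / 3) := by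
    refine h.trans ?_
    rw [div_le_iff₀ (by linarith)]
    have : 0 ≤ |x| ^ 3 := by positivity
    nlinarith
  have e : (1 + x) * Real.log (1 + x) - x - x ^ 2 / 2 =
      (1 + x) * E + x ^ 3 * (-(1 / 6) + x / 3) := by
    rw [hE]; ring
  rw [e]
  have h1 : |1 + x| ≤ 5 / 4 := by
    have := abs_add_le 1 x
    rw [abs_one] at this; linarith
  have h2 : |-(1 / 6) + x / 3| ≤ 1 / 4 := by
    obtain ⟨h3, h4⟩ := abs_le.1 hx
    rw [abs_le]; constructor <;> linarith
  calc _ ≤ |1 + x| * |E| + |x| ^ 3 * |-(1 / 6) + x / 3| := by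
        refine (abs_add_le _ _).trans_eq ?_
        rw [abs_mul, abs_mul, abs_pow]
    _ ≤ 5 / 4 * (|x| ^ 3 * (1 / 3)) + |x| ^ 3 * (1 / 4) := by gcongr
    _ ≤ |x| ^ 3 := by
        have : 0 ≤ |x| ^ 3 := by positivity
        linarith

/-- A probability density of the form `C exp(-N²/2)` for a continuous seminorm `N`. -/
structure IsGaussianDensity {d : ℕ} (N : Seminorm ℝ (Fin d → ℝ)) (C : ℝ) : Prop where
  cont : Continuous N
  nonneg : 0 ≤ C
  integrable : Integrable fun z => C * Real.exp (-(N z) ^ 2 / 2)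
  integral_eq : ∫ z, C * Real.exp (-(N z) ^ 2 / 2) = 1

/-- The mass that the density `C exp(-N²/2)` gives to the ball `N ≤ s`. -/
def ballMass {d : ℕ} (N : Seminorm ℝ (Fin d → ℝ)) (C s : ℝ) : ℝ :=
  ∫ z in {z | N z ≤ s}, C * Real.exp (-(N z) ^ 2 / 2)

namespace IsGaussianDensity

variable {d : ℕ} {N : Seminorm ℝ (Fin d → ℝ)} {C : ℝ}

lemma measurableSet_ball (h : IsGaussianDensity N C) (s : ℝ) : MeasurableSet {z | N z ≤ s} :=
  (isClosed_le h.cont continuous_const).measurableSet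

lemma density_nonneg (h : IsGaussianDensity N C) (z : Fin d → ℝ) :
    0 ≤ C * Real.exp (-(N z) ^ 2 / 2) := mul_nonneg h.nonneg (Real.exp_pos _).le

lemma ballMass_nonneg (h : IsGaussianDensity N C) (s : ℝ) : 0 ≤ ballMass N C s :=
  setIntegral_nonneg (h.measurableSet_ball s) fun z _ => h.density_nonneg z

lemma ballMass_le_one (h : IsGaussianDensity N C) (s : ℝ) : ballMass N C s ≤ 1 := by
  rw [← h.integral_eq]
  exact setIntegral_le_integral h.integrable (.of_forall h.density_nonneg)

lemma ballMass_mono (h : IsGaussianDensity N C) {s t : ℝ} (hst : s ≤ t) :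
    ballMass N C s ≤ ballMass N C t :=
  setIntegral_mono_set h.integrable.integrableOn (.of_forall h.density_nonneg)
    (Filter.Eventually.of_forall fun _ hz => le_trans hz hst)

open scoped Pointwise in
lemma ballMass_scale {a : ℝ} (ha : 0 < a) (s : ℝ) :
    ballMass N C (a * s) =
      a ^ d * ∫ z in {z | N z ≤ s}, C * Real.exp (-(a * N z) ^ 2 / 2) := by
  have key := Measure.setIntegral_comp_smul_of_pos (volume : Measure (Fin d → ℝ))
    (fun z => C * Real.exp (-(N z) ^ 2 / 2)) {z | N z ≤ s} ha
  have hs : a • {z : Fin d → ℝ | N z ≤ s} = {z | N z ≤ a * s} := by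
    ext z
    rw [Set.mem_smul_set_iff_inv_smul_mem₀ ha.ne', Set.mem_ofPred_eq, Set.mem_ofPred_eq,
      map_smul_eq_mul, Real.norm_of_nonneg (inv_nonneg.2 ha.le), inv_mul_le_iff₀ ha]
  simp only [map_smul_eq_mul, Real.norm_of_nonneg ha.le, hs, Module.finrank_fin_fun,
    smul_eq_mul] at key
  rw [key, ballMass, mul_inv_cancel_left₀ (by positivity)]

lemma ballMass_scale_le (h : IsGaussianDensity N C) {a : ℝ} (ha : 1 ≤ a) (s : ℝ) :
    ballMass N C (a * s) ≤ a ^ d * ballMass N C s := by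
  rw [ballMass_scale (by linarith)]
  refine mul_le_mul_of_nonneg_left ?_ (by positivity)
  refine integral_mono_of_nonneg (.of_forall fun z => mul_nonneg h.nonneg (Real.exp_pos _).le)
    h.integrable.integrableOn (.of_forall fun z => ?_)
  refine mul_le_mul_of_nonneg_left (Real.exp_le_exp.2 ?_) h.nonneg
  have : 0 ≤ N z := apply_nonneg N z
  have : N z ≤ a * N z := le_mul_of_one_le_left this ha
  have : N z ^ 2 ≤ (a * N z) ^ 2 := by gcongr
  linarith

lemma ballMass_le (h : IsGaussianDensity N C) (hd : d ≠ 0) {s : ℝ} (hs : 0 ≤ s) :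
    ballMass N C s ≤ 2 * s := by
  have pos : ∀ t : ℝ, 0 < t → ballMass N C t ≤ 2 * t := by
    intro t ht
    rcases le_total (1 / 2) t with h2 | h2
    · linarith [h.ballMass_le_one t]
    have hb : (∫ z in {z | N z ≤ 1}, C * Real.exp (-(t * N z) ^ 2 / 2)) ≤
        ∫ z in {z | N z ≤ 1}, Real.exp (1 / 2) * (C * Real.exp (-(N z) ^ 2 / 2)) := by
      refine integral_mono_of_nonneg (.of_forall fun z => mul_nonneg h.nonneg (Real.exp_pos _).le)
        (h.integrable.const_mul _).integrableOn
        (ae_restrict_of_forall_mem (h.measurableSet_ball 1) fun z hz => ?_)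
      have hz1 : N z ≤ 1 := hz
      have hz0 : 0 ≤ N z := apply_nonneg N z
      beta_reduce
      rw [mul_left_comm, ← Real.exp_add]
      refine mul_le_mul_of_nonneg_left (Real.exp_le_exp.2 ?_) h.nonneg
      nlinarith [sq_nonneg (t * N z)]
    rw [integral_const_mul (Real.exp (1 / 2))] at hb
    have e := ballMass_scale (N := N) (C := C) ht 1
    rw [mul_one] at e
    have hexp : Real.exp (1 / 2) ≤ 2 := by
      rw [← Real.le_log_iff_exp_le two_pos]
      linarith [Real.log_two_gt_d9]
    have htd : t ^ d ≤ t := pow_le_of_le_one ht.le (by linarith) hd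
    have h1 := h.ballMass_le_one 1
    have h0 := h.ballMass_nonneg 1
    calc ballMass N C t ≤ t ^ d * (Real.exp (1 / 2) * ballMass N C 1) := by
          rw [e]; exact mul_le_mul_of_nonneg_left hb (by positivity)
      _ ≤ t * (2 * 1) := by gcongr
      _ = 2 * t := by ring
  refine le_of_forall_pos_le_add fun ε hε => ?_
  refine (h.ballMass_mono (t := s + ε / 2) (by linarith)).trans ((pos _ (by linarith)).trans ?_)
  linarith

lemma ballMass_sub_le (h : IsGaussianDensity N C) (hd : d ≠ 0) {s t : ℝ} (hs : 0 ≤ s)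
    (hst : s ≤ t) : ballMass N C t - ballMass N C s ≤ 4 * (d + 1) * (t - s) := by
  have hd' : (1 : ℝ) ≤ d := by exact_mod_cast Nat.one_le_iff_ne_zero.2 hd
  rcases lt_or_ge s (d * (t - s)) with h1 | h1
  · have := h.ballMass_le hd (hs.trans hst)
    have := h.ballMass_nonneg s
    nlinarith
  rcases eq_or_lt_of_le hst with rfl | hlt
  · simp
  have hs' : 0 < s := lt_of_lt_of_le (by nlinarith) h1
  set r := (t - s) / s with hr
  have hr0 : 0 ≤ r := div_nonneg (by linarith) hs
  have hdr : d * r ≤ 1 := by rw [hr, ← mul_div_assoc]; exact (div_le_one hs').2 h1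
  have e : (1 + r) * s = t := by rw [hr]; field_simp; ring
  have h2 := h.ballMass_scale_le (a := 1 + r) (by linarith) s
  rw [e] at h2
  have h3 : (1 + r) ^ d ≤ 1 + 2 * (d * r) := by
    calc (1 + r) ^ d ≤ Real.exp r ^ d := by gcongr; linarith [Real.add_one_le_exp r]
      _ = Real.exp (d * r) := by rw [← Real.exp_nat_mul]
      _ ≤ 1 + 2 * (d * r) := by
        have h0 : 0 ≤ d * r := by positivity
        have := Real.abs_exp_sub_one_le (x := d * r) (by rwa [abs_of_nonneg h0])
        rw [abs_of_nonneg h0] at this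
        linarith [le_abs_self (Real.exp (d * r) - 1)]
  have h4 := h.ballMass_le hd hs
  have h5 := h.ballMass_nonneg s
  have h6 : r * s = t - s := by rw [hr]; field_simp
  calc _ ≤ (1 + 2 * (d * r)) * ballMass N C s - ballMass N C s := by
        gcongr; exact h2.trans (by gcongr)
    _ = 2 * (d * r) * ballMass N C s := by ring
    _ ≤ 2 * (d * r) * (2 * s) := by gcongr
    _ = 4 * d * (t - s) := by rw [← h6]; ring
    _ ≤ _ := by nlinarith

lemma one_sub_ballMass_le (h : IsGaussianDensity N C) {s : ℝ} (hs : 0 ≤ s) :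
    1 - ballMass N C s ≤ √2 ^ d * Real.exp (-s ^ 2 / 4) := by
  have hm := h.measurableSet_ball s
  have hsplit := integral_add_compl hm h.integrable
  rw [h.integral_eq] at hsplit
  have e : 1 - ballMass N C s =
      ∫ z in {z | N z ≤ s}ᶜ, C * Real.exp (-(N z) ^ 2 / 2) := by
    rw [ballMass]; linarith
  have hsq : √2 ≠ 0 := by positivity
  have hcomp : ∀ z, C * Real.exp (-(N ((√2)⁻¹ • z)) ^ 2 / 2) =
      C * Real.exp (-(N z) ^ 2 / 4) := by
    intro z
    rw [map_smul_eq_mul, Real.norm_of_nonneg (by positivity), mul_pow, inv_pow,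
      Real.sq_sqrt two_pos.le]
    ring_nf
  have hint : Integrable fun z => C * Real.exp (-(N z) ^ 2 / 4) := by
    have := h.integrable.comp_smul (inv_ne_zero hsq)
    simpa only [hcomp] using this
  have hval : ∫ z, C * Real.exp (-(N z) ^ 2 / 4) = √2 ^ d := by
    have := Measure.integral_comp_inv_smul (volume : Measure (Fin d → ℝ))
      (fun z => C * Real.exp (-(N z) ^ 2 / 2)) √2
    simp only [hcomp] at this
    rw [this, h.integral_eq, Module.finrank_fin_fun, abs_of_nonneg (by positivity), smul_eq_mul,
      mul_one]
  rw [e]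
  calc _ ≤ ∫ z in {z | N z ≤ s}ᶜ,
        Real.exp (-s ^ 2 / 4) * (C * Real.exp (-(N z) ^ 2 / 4)) := by
        refine integral_mono_of_nonneg (.of_forall fun z => h.density_nonneg z)
          (hint.const_mul _).integrableOn (ae_restrict_of_forall_mem hm.compl fun z hz => ?_)
        have hz1 : s < N z := not_le.1 hz
        beta_reduce
        rw [mul_left_comm, ← Real.exp_add]
        refine mul_le_mul_of_nonneg_left (Real.exp_le_exp.2 ?_) h.nonneg
        nlinarith
    _ ≤ ∫ z, Real.exp (-s ^ 2 / 4) * (C * Real.exp (-(N z) ^ 2 / 4)) :=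
        setIntegral_le_integral (hint.const_mul _) (.of_forall fun z =>
          mul_nonneg (Real.exp_pos _).le (mul_nonneg h.nonneg (Real.exp_pos _).le))
    _ = _ := by rw [integral_const_mul, hval, mul_comm]

end IsGaussianDensity

/-- The increment of `extV` : the vector `z` together with `-∑ z`. -/
def centExt (d : ℕ) : (Fin d → ℝ) →ₗ[ℝ] (Fin (d + 1) → ℝ) where
  toFun z := Fin.snoc z (-∑ i, z i)
  map_add' x y := by
    ext i
    refine Fin.lastCases ?_ (fun j => ?_) i
    · simp [sum_add_distrib]; ring
    · simp
  map_smul' c x := by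
    ext i
    refine Fin.lastCases ?_ (fun j => ?_) i
    · simp [mul_sum]
    · simp

@[simp] lemma centExt_castSucc {d : ℕ} (z : Fin d → ℝ) (i : Fin d) :
    centExt d z i.castSucc = z i := by simp [centExt]

@[simp] lemma centExt_last {d : ℕ} (z : Fin d → ℝ) :
    centExt d z (Fin.last d) = -∑ i, z i := by simp [centExt]

@[simp] lemma extP_castSucc {d : ℕ} (p : Fin d → ℝ) (i : Fin d) :
    extP d p i.castSucc = p i := by simp [extP]

@[simp] lemma extP_last {d : ℕ} (p : Fin d → ℝ) :
    extP d p (Fin.last d) = 1 - ∑ i, p i := by simp [extP]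

lemma extP_pos {d : ℕ} {p : Fin d → ℝ} (hp : p ∈ simplexInt d) (i : Fin (d + 1)) :
    0 < extP d p i := by
  refine Fin.lastCases ?_ (fun j => ?_) i
  · simpa using hp.2
  · simpa using (hp.1 j).1

lemma sum_extP (d : ℕ) (p : Fin d → ℝ) : ∑ i, extP d p i = 1 := by
  simp [Fin.sum_univ_castSucc]

/-- The linear map `z ↦ (centExt z i / √(a i))`. -/
def weightedExt (d : ℕ) (a : Fin (d + 1) → ℝ) :
    (Fin d → ℝ) →ₗ[ℝ] EuclideanSpace ℝ (Fin (d + 1)) where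
  toFun z := WithLp.toLp 2 fun i => centExt d z i / √(a i)
  map_add' x y := by ext i; simp [add_div]
  map_smul' c x := by ext i; simp [mul_div_assoc]

/-- The seminorm `z ↦ √(∑ (centExt z i)² / a i)`. -/
def simplexNorm (d : ℕ) (a : Fin (d + 1) → ℝ) : Seminorm ℝ (Fin d → ℝ) :=
  (normSeminorm ℝ (EuclideanSpace ℝ (Fin (d + 1)))).comp (weightedExt d a)

lemma simplexNorm_sq {d : ℕ} {a : Fin (d + 1) → ℝ} (ha : ∀ i, 0 ≤ a i) (z : Fin d → ℝ) :
    simplexNorm d a z ^ 2 = ∑ i, centExt d z i ^ 2 / a i := by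
  rw [simplexNorm, Seminorm.comp_apply, coe_normSeminorm, EuclideanSpace.norm_sq_eq]
  refine sum_congr rfl fun i _ => ?_
  simp [weightedExt, div_pow, Real.sq_sqrt (ha i)]

lemma continuous_simplexNorm (d : ℕ) (a : Fin (d + 1) → ℝ) : Continuous (simplexNorm d a) :=
  continuous_norm.comp (weightedExt d a).continuous_of_finiteDimensional

lemma covM_mulVec {d : ℕ} {p : Fin d → ℝ} (hp : p ∈ simplexInt d) (x : Fin d → ℝ) :
    covM d p *ᵥ (fun i => x i / p i + (∑ j, x j) / (1 - ∑ j, p j)) = x := by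
  have hl : 1 - ∑ j, p j ≠ 0 := (sub_pos.2 hp.2).ne'
  have hs : ∑ j, p j * (x j / p j + (∑ j, x j) / (1 - ∑ j, p j)) =
      ∑ j, x j + (∑ j, p j) * ((∑ j, x j) / (1 - ∑ j, p j)) := by
    rw [sum_mul, ← sum_add_distrib]
    refine sum_congr rfl fun j _ => ?_
    have := (hp.1 j).1.ne'
    field_simp
  ext i
  have hi := (hp.1 i).1.ne'
  rw [covM, sub_mulVec, Pi.sub_apply, mulVec_diagonal, vecMulVec_mulVec]
  simp only [dotProduct, hs, Pi.smul_apply, MulOpposite.smul_eq_mul_unop, MulOpposite.unop_op]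
  field_simp
  ring

lemma det_covM {d : ℕ} {p : Fin d → ℝ} (hp : p ∈ simplexInt d) :
    (covM d p).det = ∏ i, extP d p i := by
  have hdet : (diagonal p).det = ∏ i, p i := det_diagonal
  have h0 : ∏ i, p i ≠ 0 := prod_ne_zero_iff.2 fun i _ => (hp.1 i).1.ne'
  have e : covM d p = diagonal p + replicateCol Unit (-p) * replicateRow Unit p := by
    rw [covM, sub_eq_add_neg, ← neg_vecMulVec, vecMulVec_eq Unit]
  rw [e, det_add_replicateCol_mul_replicateRow (by rw [hdet]; exact h0.isUnit), hdet, det_unique,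
    Fin.prod_univ_castSucc]
  simp only [extP_castSucc, extP_last]
  congr 1
  have hinv : (diagonal p)⁻¹ = diagonal fun i => (p i)⁻¹ := by
    refine inv_eq_right_inv ?_
    rw [diagonal_mul_diagonal, ← diagonal_one]
    congr 1
    ext i
    exact mul_inv_cancel₀ (hp.1 i).1.ne'
  simp only [hinv, Matrix.add_apply, one_apply_eq, Matrix.mul_apply, replicateRow_apply,
    replicateCol_apply, diagonal_apply, Pi.neg_apply]
  simp only [mul_ite, mul_zero, sum_ite_eq', mem_univ, if_true, sub_eq_add_neg, ← sum_neg_distrib]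
  congr 1
  refine sum_congr rfl fun i _ => ?_
  rw [mul_inv_cancel₀ (hp.1 i).1.ne', one_mul]

lemma isUnit_det_covM {d : ℕ} {p : Fin d → ℝ} (hp : p ∈ simplexInt d) :
    IsUnit (covM d p).det := by
  rw [det_covM hp]
  exact (prod_ne_zero_iff.2 fun i _ => (extP_pos hp i).ne').isUnit

lemma quadForm_eq {d : ℕ} {p : Fin d → ℝ} (hp : p ∈ simplexInt d) (x : Fin d → ℝ) :
    quadForm d p x = ∑ i, centExt d x i ^ 2 / extP d p i := by
  have h : (covM d p)⁻¹ *ᵥ x = fun i => x i / p i + (∑ j, x j) / (1 - ∑ j, p j) := by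
    conv_lhs => rw [← covM_mulVec hp x]
    rw [mulVec_mulVec, nonsing_inv_mul _ (isUnit_det_covM hp), one_mulVec]
  rw [quadForm, h, Fin.sum_univ_castSucc]
  simp only [dotProduct, centExt_castSucc, centExt_last, extP_castSucc, extP_last, mul_add,
    sum_add_distrib, ← sum_mul]
  congr 1
  · exact sum_congr rfl fun i _ => by ring
  · ring

lemma posDef_inv_covM {d : ℕ} {p : Fin d → ℝ} (hp : p ∈ simplexInt d) :
    ((covM d p)⁻¹).PosDef := by
  refine PosDef.of_dotProduct_mulVec_pos ?_ fun x hx => ?_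
  · refine IsHermitian.inv ?_
    rw [covM]
    refine IsHermitian.sub (isHermitian_diagonal p) ?_
    ext i j
    simp [vecMulVec_apply, mul_comm]
  · have h := quadForm_eq hp x
    rw [quadForm] at h
    rw [star_trivial, h, Fin.sum_univ_castSucc]
    obtain ⟨j, hj⟩ := Function.ne_iff.1 hx
    have hj' : x j ≠ 0 := hj
    refine add_pos_of_pos_of_nonneg (sum_pos' (fun i _ => ?_) ⟨j, mem_univ j, ?_⟩) ?_
    · exact div_nonneg (sq_nonneg _) (extP_pos hp _).le
    · rw [centExt_castSucc]
      exact div_pos (by positivity) (extP_pos hp _)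
    · exact div_nonneg (sq_nonneg _) (extP_pos hp _).le

lemma integral_exp_neg_sum_sq (d : ℕ) :
    ∫ x : Fin d → ℝ, Real.exp (-(1 / 2) * ∑ i, x i ^ 2) = √((2 * π) ^ d) := by
  have := integral_fintype_prod_volume_eq_pow (ι := Fin d)
    (fun x : ℝ => Real.exp (-(1 / 2) * x ^ 2))
  simp only [← Real.exp_sum, ← mul_sum] at this
  rw [this, integral_gaussian, Fintype.card_fin, Real.sqrt_eq_rpow, Real.sqrt_eq_rpow,
    ← Real.rpow_natCast, ← Real.rpow_mul (by positivity), ← Real.rpow_natCast,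
    ← Real.rpow_mul (by positivity), mul_comm (1 / 2 : ℝ)]
  congr 1
  ring

open scoped MatrixOrder in
lemma integral_gaussDens {d : ℕ} {p : Fin d → ℝ} (hp : p ∈ simplexInt d) :
    ∫ x, gaussDens d p x = 1 := by
  obtain ⟨B, hB⟩ :=
    CStarAlgebra.nonneg_iff_eq_star_mul_self.1 (posDef_inv_covM hp).posSemidef.nonneg
  rw [star_eq_conjTranspose, conjTranspose_eq_transpose_of_trivial] at hB
  have hq : ∀ x, quadForm d p x = ∑ i, (toLin' B x) i ^ 2 := by
    intro x
    rw [quadForm, hB, ← mulVec_mulVec, dotProduct_mulVec, vecMul_transpose]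
    simp [dotProduct, sq]
  have hprod : 0 < ∏ i, extP d p i := prod_pos fun i _ => extP_pos hp i
  have hdet : (∏ i, extP d p i)⁻¹ = B.det ^ 2 := by
    rw [← det_covM hp, ← Ring.inverse_eq_inv', ← det_nonsing_inv, hB, det_mul, det_transpose, sq]
  have hB0 : B.det ≠ 0 := by
    intro h
    rw [h] at hdet
    exact (inv_pos.2 hprod).ne' (by rw [hdet]; ring)
  have hmap : ∫ x, Real.exp (-(1 / 2) * ∑ i, (toLin' B x) i ^ 2) =
      |B.det⁻¹| * √((2 * π) ^ d) := by
    have h1 := Real.map_matrix_volume_pi_eq_smul_volume_pi hB0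
    have h2 := integral_map (μ := (volume : Measure (Fin d → ℝ))) (φ := toLin' B)
      (f := fun x => Real.exp (-(1 / 2) * ∑ i, x i ^ 2))
      (toLin' B).continuous_of_finiteDimensional.aemeasurable
      (by fun_prop : Continuous fun x : Fin d → ℝ =>
        Real.exp (-(1 / 2) * ∑ i, x i ^ 2)).aestronglyMeasurable
    rw [← h2, h1, integral_smul_measure, ENNReal.toReal_ofReal (abs_nonneg _),
      integral_exp_neg_sum_sq, smul_eq_mul]
  have habs : |B.det⁻¹| = √(∏ i, extP d p i) := by
    rw [← Real.sqrt_sq_eq_abs, inv_pow, ← hdet, inv_inv]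
  simp only [gaussDens, hq]
  rw [integral_div, hmap, habs, mul_comm, ← Real.sqrt_mul (by positivity), div_self]
  exact (Real.sqrt_pos.2 (by positivity)).ne'

/-- The normalising constant of the approximating Gaussian density. -/
def gaussConst (d n : ℕ) (p : Fin d → ℝ) : ℝ :=
  (n : ℝ) ^ (-(d : ℝ) / 2) / √((2 * π) ^ d * ∏ i, extP d p i)

lemma gaussConst_pos {d n : ℕ} (hn : n ≠ 0) {p : Fin d → ℝ} (hp : p ∈ simplexInt d) :
    0 < gaussConst d n p := by
  have hprod : 0 < ∏ i, extP d p i := prod_pos fun i _ => extP_pos hp i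
  have : (0 : ℝ) < n := by positivity
  rw [gaussConst]
  positivity

/-- The seminorm of the approximating Gaussian density, in the unscaled coordinates. -/
abbrev gaussNorm (d n : ℕ) (p : Fin d → ℝ) : Seminorm ℝ (Fin d → ℝ) :=
  simplexNorm d fun i => n * extP d p i

lemma delVec_eq (d n : ℕ) (p v : Fin d → ℝ) :
    delVec d n p v = (√n)⁻¹ • (v - (n : ℝ) • p) := by
  ext i
  simp [delVec, del, div_eq_inv_mul]

lemma quadForm_smul {d n : ℕ} {p : Fin d → ℝ} (hp : p ∈ simplexInt d) (z : Fin d → ℝ) :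
    quadForm d p ((√n)⁻¹ • z) = gaussNorm d n p z ^ 2 := by
  rw [quadForm_eq hp, simplexNorm_sq fun i => mul_nonneg n.cast_nonneg (extP_pos hp i).le]
  refine sum_congr rfl fun i _ => ?_
  rw [map_smul, Pi.smul_apply, smul_eq_mul, mul_pow, inv_pow, Real.sq_sqrt n.cast_nonneg,
    ← div_div, inv_mul_eq_div]

lemma scaled_gaussDens_eq {d n : ℕ} {p : Fin d → ℝ} (hp : p ∈ simplexInt d) (z : Fin d → ℝ) :
    (n : ℝ) ^ (-(d : ℝ) / 2) * gaussDens d p ((√n)⁻¹ • z) =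
      gaussConst d n p * Real.exp (-(gaussNorm d n p z) ^ 2 / 2) := by
  rw [gaussDens, quadForm_smul hp, gaussConst]
  rw [show -(1 / 2 : ℝ) * gaussNorm d n p z ^ 2 = -(gaussNorm d n p z) ^ 2 / 2 by ring]
  ring

lemma isGaussianDensity_gaussNorm {d n : ℕ} (hn : n ≠ 0) {p : Fin d → ℝ}
    (hp : p ∈ simplexInt d) : IsGaussianDensity (gaussNorm d n p) (gaussConst d n p) := by
  have hn' : (0 : ℝ) < n := by positivity
  have hint : ∫ z, gaussConst d n p * Real.exp (-(gaussNorm d n p z) ^ 2 / 2) = 1 := by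
    simp only [← scaled_gaussDens_eq hp]
    rw [integral_const_mul, Measure.integral_comp_inv_smul, integral_gaussDens hp,
      Module.finrank_fin_fun, abs_of_nonneg (by positivity), smul_eq_mul, mul_one,
      Real.sqrt_eq_rpow, ← Real.rpow_natCast, ← Real.rpow_mul hn'.le, ← Real.rpow_add hn']
    rw [show -(d : ℝ) / 2 + 1 / 2 * d = 0 by ring, Real.rpow_zero]
  refine ⟨continuous_simplexNorm _ _, (gaussConst_pos hn hp).le, ?_, hint⟩
  by_contra h
  rw [integral_undef h] at hint
  exact zero_ne_one hint

lemma gaussDens_le_iff {d n : ℕ} {p : Fin d → ℝ} (hp : p ∈ simplexInt d) (v y : Fin d → ℝ) :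
    gaussDens d p (delVec d n p v) ≤ gaussDens d p (delVec d n p y) ↔
      gaussNorm d n p (y - (n : ℝ) • p) ≤ gaussNorm d n p (v - (n : ℝ) • p) := by
  have hprod : 0 < ∏ i, extP d p i := prod_pos fun i _ => extP_pos hp i
  have hpos : 0 < √((2 * π) ^ d * ∏ i, extP d p i) := by positivity
  rw [gaussDens, gaussDens, div_le_div_iff_of_pos_right hpos, Real.exp_le_exp, delVec_eq,
    delVec_eq, quadForm_smul hp, quadForm_smul hp, ← sq_le_sq₀ (apply_nonneg _ _)
    (apply_nonneg _ _)]
  constructor <;> intro h <;> linarith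

lemma setIntegral_gaussDens_eq {d n : ℕ} {p : Fin d → ℝ} (hp : p ∈ simplexInt d)
    (v : Fin d → ℝ) :
    ∫ y in {y | gaussDens d p (delVec d n p v) ≤ gaussDens d p (delVec d n p y)},
        (n : ℝ) ^ (-(d : ℝ) / 2) * gaussDens d p (delVec d n p y) =
      ballMass (gaussNorm d n p) (gaussConst d n p) (gaussNorm d n p (v - (n : ℝ) • p)) := by
  set N := gaussNorm d n p
  have hset : {y | gaussDens d p (delVec d n p v) ≤ gaussDens d p (delVec d n p y)} =
      (fun y => y - (n : ℝ) • p) ⁻¹' {z | N z ≤ N (v - (n : ℝ) • p)} := by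
    ext y
    exact gaussDens_le_iff hp v y
  have hfun : (fun y => (n : ℝ) ^ (-(d : ℝ) / 2) * gaussDens d p (delVec d n p y)) =
      fun y => (fun z => gaussConst d n p * Real.exp (-(N z) ^ 2 / 2)) (y - (n : ℝ) • p) := by
    ext y
    rw [delVec_eq, scaled_gaussDens_eq hp]
  rw [hset, hfun, ballMass]
  exact (measurePreserving_sub_right volume ((n : ℝ) • p)).setIntegral_preimage_emb
    (measurableEmbedding_subRight _)
    (fun z => gaussConst d n p * Real.exp (-(N z) ^ 2 / 2)) _

/-- The cell counts of all `d + 1` cells. -/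
def extK (d n : ℕ) (k : Fin d → ℕ) : Fin (d + 1) → ℕ := Fin.snoc k (n - ∑ i, k i)

/-- The support of the multinomial distribution. -/
def multSupport (d n : ℕ) : Finset (Fin d → ℕ) :=
  (Fintype.piFinset fun _ => range (n + 1)).filter fun k => ∑ i, k i ≤ n

@[simp] lemma extK_castSucc {d n : ℕ} (k : Fin d → ℕ) (i : Fin d) :
    extK d n k i.castSucc = k i := by simp [extK]

@[simp] lemma extK_last {d n : ℕ} (k : Fin d → ℕ) :
    extK d n k (Fin.last d) = n - ∑ i, k i := by simp [extK]

lemma mem_multSupport {d n : ℕ} {k : Fin d → ℕ} : k ∈ multSupport d n ↔ ∑ i, k i ≤ n := by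
  simp only [multSupport, mem_filter, Fintype.mem_piFinset, mem_range, and_iff_right_iff_imp]
  intro h i
  exact Nat.lt_succ_of_le ((single_le_sum (fun _ _ => Nat.zero_le _) (mem_univ i)).trans h)

lemma card_multSupport_le (d n : ℕ) : #(multSupport d n) ≤ (n + 1) ^ d := by
  refine (card_filter_le _ _).trans ?_
  simp

lemma sum_extK {d n : ℕ} {k : Fin d → ℕ} (hk : k ∈ multSupport d n) :
    ∑ i, extK d n k i = n := by
  rw [mem_multSupport] at hk
  simp [Fin.sum_univ_castSucc, hk]

lemma multinomialPMF_of_mem {d n : ℕ} (p : Fin d → ℝ) {k : Fin d → ℕ}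
    (hk : k ∈ multSupport d n) :
    multinomialPMF d n p k = (n.factorial : ℝ) / (∏ i, ((extK d n k i).factorial : ℝ)) *
      ∏ i, extP d p i ^ extK d n k i := by
  rw [multinomialPMF, if_pos (mem_multSupport.1 hk)]
  simp [Fin.prod_univ_castSucc]

lemma multinomialPMF_of_not_mem {d n : ℕ} (p : Fin d → ℝ) {k : Fin d → ℕ}
    (hk : k ∉ multSupport d n) : multinomialPMF d n p k = 0 := by
  rw [multinomialPMF, if_neg (mt mem_multSupport.2 hk)]

lemma multinomialPMF_nonneg {d n : ℕ} {p : Fin d → ℝ} (hp : p ∈ simplexInt d)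
    (k : Fin d → ℕ) : 0 ≤ multinomialPMF d n p k := by
  by_cases hk : k ∈ multSupport d n
  · rw [multinomialPMF_of_mem p hk]
    have := fun i => (extP_pos hp i).le
    exact mul_nonneg (by positivity) (prod_nonneg fun i _ => pow_nonneg (this i) _)
  · rw [multinomialPMF_of_not_mem p hk]

lemma multinomialPMF_pos {d n : ℕ} {p : Fin d → ℝ} (hp : p ∈ simplexInt d)
    {k : Fin d → ℕ} (hk : k ∈ multSupport d n) : 0 < multinomialPMF d n p k := by
  rw [multinomialPMF_of_mem p hk]
  exact mul_pos (by positivity) (prod_pos fun i _ => pow_pos (extP_pos hp i) _)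

lemma sum_multinomial_weights (d n : ℕ) (w : Fin (d + 1) → ℝ) :
    ∑ k ∈ multSupport d n, (n.factorial : ℝ) / (∏ i, ((extK d n k i).factorial : ℝ)) *
      ∏ i, w i ^ extK d n k i = (∑ i, w i) ^ n := by
  rw [sum_pow_eq_sum_piAntidiag]
  refine sum_bij' (fun k _ => extK d n k) (fun f _ => Fin.init f) (fun k hk => ?_)
    (fun f hf => ?_) (fun k _ => ?_) (fun f hf => ?_) (fun k hk => ?_)
  · simp [sum_extK hk]
  · simp only [mem_piAntidiag, mem_univ, implies_true, and_true] at hf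
    rw [mem_multSupport, ← hf, Fin.sum_univ_castSucc]
    exact Nat.le_add_right _ _
  · simp [extK]
  · simp only [mem_piAntidiag, mem_univ, implies_true, and_true] at hf
    ext i
    refine Fin.lastCases ?_ (fun j => ?_) i
    · rw [extK_last, ← hf, Fin.sum_univ_castSucc]
      simp [Fin.init]
    · simp [Fin.init]
  · congr 1
    have h := Nat.multinomial_spec univ (extK d n k)
    rw [sum_extK hk] at h
    rw [div_eq_iff (by positivity), mul_comm]
    exact_mod_cast h.symm

lemma sum_multinomialPMF (d n : ℕ) (p : Fin d → ℝ) :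
    ∑ k ∈ multSupport d n, multinomialPMF d n p k = 1 := by
  rw [sum_congr rfl fun k hk => multinomialPMF_of_mem p hk, sum_multinomial_weights, sum_extP,
    one_pow]

/-- The squared Hellinger distance between the empirical and the theoretical cell frequencies,
scaled by `n`. -/
def hellSq (d n : ℕ) (p : Fin d → ℝ) (k : Fin d → ℕ) : ℝ :=
  ∑ i, (√(extK d n k i) - √(n * extP d p i)) ^ 2

lemma multinomialPMF_le_exp {d n : ℕ} (hn : n ≠ 0) {p : Fin d → ℝ} (hp : p ∈ simplexInt d)
    {k : Fin d → ℕ} (hk : k ∈ multSupport d n) :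
    multinomialPMF d n p k ≤ Real.exp (-hellSq d n p k) := by
  have hn' : (0 : ℝ) < n := by positivity
  have hsumK : ∑ i, (extK d n k i : ℝ) = n := by exact_mod_cast sum_extK hk
  have hfactor : ∀ i, extP d p i ^ extK d n k i ≤ ((extK d n k i : ℝ) / n) ^ extK d n k i *
      Real.exp (2 * (√(extK d n k i) * √(n * extP d p i) - extK d n k i)) := by
    intro i
    set m := extK d n k i
    have hq := extP_pos hp i
    set q := extP d p i
    rcases Nat.eq_zero_or_pos m with h0 | h0
    · simp [h0]
    have hm : (0 : ℝ) < m := by exact_mod_cast h0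
    set r := √(n * q) / √m with hr
    have hsm : √(m : ℝ) ^ 2 = m := Real.sq_sqrt hm.le
    have e1 : q = (m : ℝ) / n * r ^ 2 := by
      rw [hr, div_pow, hsm, Real.sq_sqrt (by positivity)]
      field_simp
    have e2 : 2 * (√(m : ℝ) * √(n * q) - m) = m * (2 * (r - 1)) := by
      have : √(m : ℝ) * √(n * q) = m * r := by
        rw [hr]
        nth_rw 2 [← hsm]
        field_simp
      rw [this]; ring
    rw [e2, Real.exp_nat_mul, ← mul_pow]
    refine pow_le_pow_left₀ hq.le ?_ m
    conv_lhs => rw [e1]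
    refine mul_le_mul_of_nonneg_left ?_ (by positivity)
    have h1 : r ≤ Real.exp (r - 1) := by linarith [Real.add_one_le_exp (r - 1)]
    calc r ^ 2 ≤ Real.exp (r - 1) ^ 2 := by gcongr
      _ = Real.exp (2 * (r - 1)) := by rw [← Real.exp_nat_mul]; norm_num
  have hle1 : (n.factorial : ℝ) / (∏ i, ((extK d n k i).factorial : ℝ)) *
      ∏ i, ((extK d n k i : ℝ) / n) ^ extK d n k i ≤ 1 := by
    have h := sum_multinomial_weights d n fun i => (extK d n k i : ℝ) / n
    rw [← sum_div, hsumK, div_self hn'.ne', one_pow] at h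
    rw [← h]
    exact single_le_sum (f := fun l => (n.factorial : ℝ) / (∏ i, ((extK d n l i).factorial : ℝ)) *
      ∏ i, ((extK d n k i : ℝ) / n) ^ extK d n l i) (fun l _ => by positivity) hk
  have hexp : ∑ i, 2 * (√(extK d n k i) * √(n * extP d p i) - extK d n k i) =
      -hellSq d n p k := by
    have h2 : ∑ i, n * extP d p i = (n : ℝ) := by rw [← mul_sum, sum_extP, mul_one]
    have h3 : hellSq d n p k = ∑ i, ((extK d n k i : ℝ) + n * extP d p i -
        2 * (√(extK d n k i) * √(n * extP d p i))) := by
      refine sum_congr rfl fun i _ => ?_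
      rw [sub_sq, Real.sq_sqrt (Nat.cast_nonneg _),
        Real.sq_sqrt (mul_nonneg hn'.le (extP_pos hp i).le)]
      ring
    rw [h3, sum_sub_distrib, sum_add_distrib, hsumK, h2, ← mul_sum, ← mul_sum, sum_sub_distrib,
      hsumK]
    ring
  rw [multinomialPMF_of_mem p hk]
  calc _ ≤ (n.factorial : ℝ) / (∏ i, ((extK d n k i).factorial : ℝ)) *
        ∏ i, (((extK d n k i : ℝ) / n) ^ extK d n k i *
          Real.exp (2 * (√(extK d n k i) * √(n * extP d p i) - extK d n k i))) := by
        refine mul_le_mul_of_nonneg_left ?_ (by positivity)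
        exact prod_le_prod (fun i _ => pow_nonneg (extP_pos hp i).le _) fun i _ => hfactor i
    _ = ((n.factorial : ℝ) / (∏ i, ((extK d n k i).factorial : ℝ)) *
        ∏ i, ((extK d n k i : ℝ) / n) ^ extK d n k i) * Real.exp (-hellSq d n p k) := by
        rw [prod_mul_distrib, ← Real.exp_sum, hexp, mul_assoc]
    _ ≤ 1 * Real.exp (-hellSq d n p k) := by gcongr
    _ = _ := one_mul _

lemma confSum_eq (d n : ℕ) (p : Fin d → ℝ) (m : Fin d → ℕ) :
    confSum d n p m = ∑ k ∈ multSupport d n with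
      multinomialPMF d n p m ≤ multinomialPMF d n p k, multinomialPMF d n p k := by
  rw [confSum, tsum_eq_sum (s := multSupport d n), sum_filter]
  · exact sum_congr rfl fun k _ => by simp [Set.indicator_apply]
  · intro k hk
    simp [Set.indicator_apply, multinomialPMF_of_not_mem p hk]

lemma confSum_nonneg {d n : ℕ} {p : Fin d → ℝ} (hp : p ∈ simplexInt d) (m : Fin d → ℕ) :
    0 ≤ confSum d n p m := by
  rw [confSum_eq]
  exact sum_nonneg fun k _ => multinomialPMF_nonneg hp k

lemma confSum_le_one {d n : ℕ} {p : Fin d → ℝ} (hp : p ∈ simplexInt d) (m : Fin d → ℕ) :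
    confSum d n p m ≤ 1 := by
  rw [confSum_eq, ← sum_multinomialPMF d n p]
  exact sum_le_sum_of_subset_of_nonneg (filter_subset _ _)
    fun k _ _ => multinomialPMF_nonneg hp k

lemma one_sub_confSum_le {d n : ℕ} (p : Fin d → ℝ) (m : Fin d → ℕ) {ε : ℝ} (hε : 0 ≤ ε)
    (hm : multinomialPMF d n p m ≤ ε) :
    1 - confSum d n p m ≤ ((n : ℝ) + 1) ^ d * ε := by
  have h := sum_filter_add_sum_filter_not (multSupport d n)
    (fun k => multinomialPMF d n p m ≤ multinomialPMF d n p k) (multinomialPMF d n p)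
  rw [← confSum_eq, sum_multinomialPMF] at h
  have h2 : ∑ k ∈ multSupport d n with
      ¬multinomialPMF d n p m ≤ multinomialPMF d n p k, multinomialPMF d n p k ≤
      #(multSupport d n) • ε := by
    refine (sum_le_card_nsmul _ _ ε fun k hk => ?_).trans
      (nsmul_le_nsmul_left hε (card_filter_le _ _))
    exact (not_le.1 (mem_filter.1 hk).2).le.trans hm
  have h3 : (#(multSupport d n) : ℝ) ≤ ((n : ℝ) + 1) ^ d := by
    exact_mod_cast card_multSupport_le d n
  rw [nsmul_eq_mul] at h2
  have := mul_le_mul_of_nonneg_right h3 hε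
  linarith

lemma sum_multinomialPMF_far_le {d n : ℕ} (hn : n ≠ 0) {p : Fin d → ℝ} (hp : p ∈ simplexInt d)
    (A : ℝ) : ∑ k ∈ multSupport d n with A < hellSq d n p k, multinomialPMF d n p k ≤
      ((n : ℝ) + 1) ^ d * Real.exp (-A) := by
  calc _ ≤ #{k ∈ multSupport d n | A < hellSq d n p k} • Real.exp (-A) := by
        refine sum_le_card_nsmul _ _ _ fun k hk => ?_
        rw [mem_filter] at hk
        exact (multinomialPMF_le_exp hn hp hk.1).trans (Real.exp_le_exp.2 (by linarith [hk.2]))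
    _ ≤ ((n : ℝ) + 1) ^ d * Real.exp (-A) := by
        rw [nsmul_eq_mul]
        gcongr
        exact_mod_cast (card_filter_le _ _).trans (card_multSupport_le d n)

lemma centExt_castK_sub {d n : ℕ} (p : Fin d → ℝ) {k : Fin d → ℕ} (hk : k ∈ multSupport d n)
    (i : Fin (d + 1)) :
    centExt d (castK d k - (n : ℝ) • p) i = extK d n k i - n * extP d p i := by
  refine Fin.lastCases ?_ (fun j => ?_) i
  · rw [centExt_last, extK_last, extP_last, Nat.cast_sub (mem_multSupport.1 hk)]
    simp [castK, ← mul_sum]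
    ring
  · simp [castK]

lemma gaussNorm_sq {d n : ℕ} {p : Fin d → ℝ} (hp : p ∈ simplexInt d) (z : Fin d → ℝ) :
    gaussNorm d n p z ^ 2 = ∑ i, centExt d z i ^ 2 / (n * extP d p i) :=
  simplexNorm_sq (fun i => mul_nonneg n.cast_nonneg (extP_pos hp i).le) z

lemma hellSq_le_gaussNorm_sq {d n : ℕ} (hn : n ≠ 0) {p : Fin d → ℝ} (hp : p ∈ simplexInt d)
    {k : Fin d → ℕ} (hk : k ∈ multSupport d n) :
    hellSq d n p k ≤ gaussNorm d n p (castK d k - (n : ℝ) • p) ^ 2 := by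
  rw [gaussNorm_sq hp, hellSq]
  refine sum_le_sum fun i _ => ?_
  rw [centExt_castK_sub p hk]
  have ha : 0 < n * extP d p i := mul_pos (by positivity) (extP_pos hp i)
  set a := n * extP d p i
  set K := (extK d n k i : ℝ)
  have hK : 0 ≤ K := Nat.cast_nonneg _
  have e : (K - a) ^ 2 = (√K - √a) ^ 2 * (√K + √a) ^ 2 := by
    rw [← mul_pow, mul_comm, ← sq_sub_sq, Real.sq_sqrt hK, Real.sq_sqrt ha.le]
  rw [le_div_iff₀ ha, e]
  refine mul_le_mul_of_nonneg_left ?_ (sq_nonneg _)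
  calc a = (√a) ^ 2 := (Real.sq_sqrt ha.le).symm
    _ ≤ _ := by gcongr; linarith [Real.sqrt_nonneg K]

lemma gaussNorm_sq_le_of_hellSq_le {d n : ℕ} {p : Fin d → ℝ} (hp : p ∈ simplexInt d)
    {k : Fin d → ℕ} (hk : k ∈ multSupport d n) {A : ℝ}
    (hA : ∀ i, 100 * A ≤ n * extP d p i) (hA0 : 0 < A) (hkA : hellSq d n p k ≤ A) :
    gaussNorm d n p (castK d k - (n : ℝ) • p) ^ 2 ≤ 9 / 2 * A := by
  refine le_trans ?_ (mul_le_mul_of_nonneg_left hkA (by norm_num : (0 : ℝ) ≤ 9 / 2))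
  rw [gaussNorm_sq hp, hellSq, mul_sum]
  refine sum_le_sum fun i _ => ?_
  rw [centExt_castK_sub p hk]
  have hi : (√(extK d n k i) - √(n * extP d p i)) ^ 2 ≤ A :=
    (single_le_sum (f := fun i => (√(extK d n k i) - √(n * extP d p i)) ^ 2)
      (fun _ _ => sq_nonneg _) (mem_univ i)).trans hkA
  have hai := hA i
  set a := n * extP d p i
  have ha : 0 < a := by linarith
  set K := (extK d n k i : ℝ)
  have hK : 0 ≤ K := Nat.cast_nonneg _
  have e : (K - a) ^ 2 = (√K - √a) ^ 2 * (√K + √a) ^ 2 := by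
    rw [← mul_pow, mul_comm, ← sq_sub_sq, Real.sq_sqrt hK, Real.sq_sqrt ha.le]
  have hsa : √a ^ 2 = a := Real.sq_sqrt ha.le
  have h1 : √K - √a ≤ √a / 10 := by
    refine le_of_sq_le_sq ?_ (by positivity)
    rw [div_pow, hsa]
    linarith
  rw [div_le_iff₀ ha, e, mul_assoc, mul_left_comm]
  refine mul_le_mul_of_nonneg_left ?_ (sq_nonneg _)
  calc (√K + √a) ^ 2 ≤ (2.1 * √a) ^ 2 := by gcongr; linarith
    _ ≤ 9 / 2 * a := by rw [mul_pow, hsa]; nlinarith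

section Scale

variable {d n : ℕ} {p : Fin d → ℝ} {u : ℝ}

lemma abs_centExt_le (hp : p ∈ simplexInt d) (hu : 0 < u)
    (hpu : ∀ i, 1 ≤ u ^ 2 * (n * extP d p i)) (z : Fin d → ℝ) (i : Fin (d + 1)) :
    |centExt d z i| ≤ u * gaussNorm d n p z * (n * extP d p i) := by
  have ha0 : 0 ≤ n * extP d p i := mul_nonneg n.cast_nonneg (extP_pos hp i).le
  have ha : 0 < n * extP d p i := by
    refine ha0.lt_of_ne fun h => ?_
    have := hpu i
    rw [← h] at this
    linarith
  have hi : centExt d z i ^ 2 / (n * extP d p i) ≤ gaussNorm d n p z ^ 2 := by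
    rw [gaussNorm_sq hp]
    exact single_le_sum (f := fun i => centExt d z i ^ 2 / (n * extP d p i))
      (fun j _ => div_nonneg (sq_nonneg _)
        (mul_nonneg n.cast_nonneg (extP_pos hp j).le)) (mem_univ i)
  rw [div_le_iff₀ ha] at hi
  have hui := hpu i
  refine abs_le_of_sq_le_sq ?_ (by positivity)
  refine hi.trans ?_
  have : 0 ≤ gaussNorm d n p z ^ 2 * (n * extP d p i) := by positivity
  nlinarith

lemma sum_abs_centExt_div_le (hp : p ∈ simplexInt d) (hn : n ≠ 0) (hu : 0 < u)
    (hpu : ∀ i, 1 ≤ u ^ 2 * (n * extP d p i)) (z : Fin d → ℝ) :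
    ∑ i, |centExt d z i| / (n * extP d p i) ≤ u * √(d + 1) * gaussNorm d n p z := by
  have ha : ∀ i, 0 < n * extP d p i := fun i => mul_pos (by positivity) (extP_pos hp i)
  refine le_of_sq_le_sq ?_ (by positivity)
  calc (∑ i, |centExt d z i| / (n * extP d p i)) ^ 2
      ≤ #(univ : Finset (Fin (d + 1))) * ∑ i, (|centExt d z i| / (n * extP d p i)) ^ 2 :=
        sq_sum_le_card_mul_sum_sq
    _ ≤ (d + 1) * ∑ i, u ^ 2 * (centExt d z i ^ 2 / (n * extP d p i)) := by
        rw [card_univ, Fintype.card_fin]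
        push_cast
        refine mul_le_mul_of_nonneg_left (sum_le_sum fun i _ => ?_) (by positivity)
        have hi := hpu i
        have hai := ha i
        rw [div_pow, sq_abs, ← mul_div_assoc, div_le_div_iff₀ (by positivity) hai]
        have : 0 ≤ centExt d z i ^ 2 * (n * extP d p i) := by positivity
        nlinarith
    _ = (u * √(d + 1) * gaussNorm d n p z) ^ 2 := by
        rw [← mul_sum, ← gaussNorm_sq hp, mul_pow, mul_pow, Real.sq_sqrt (by positivity)]
        ring

lemma gaussNorm_le_of_abs_le (hp : p ∈ simplexInt d) (hn : n ≠ 0) (hu : 0 < u)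
    (hpu : ∀ i, 1 ≤ u ^ 2 * (n * extP d p i)) {z : Fin d → ℝ} (hz : ∀ i, |z i| ≤ 1 / 2) :
    gaussNorm d n p z ≤ u * (d + 1) / 2 := by
  refine le_of_sq_le_sq ?_ (by positivity)
  have hterm : ∀ i (c : ℝ), c ^ 2 / (n * extP d p i) ≤ u ^ 2 * c ^ 2 := by
    intro i c
    rw [div_le_iff₀ (mul_pos (by positivity) (extP_pos hp i))]
    nlinarith [hpu i, sq_nonneg c]
  have hlast : |∑ i, z i| ≤ d / 2 := by
    refine (abs_sum_le_sum_abs _ _).trans ((sum_le_sum fun i _ => hz i).trans_eq ?_)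
    simp
    ring
  calc gaussNorm d n p z ^ 2 ≤ ∑ i, u ^ 2 * centExt d z i ^ 2 := by
        rw [gaussNorm_sq hp]
        exact sum_le_sum fun i _ => hterm i _
    _ = ∑ i, u ^ 2 * |z i| ^ 2 + u ^ 2 * |∑ i, z i| ^ 2 := by
        simp [Fin.sum_univ_castSucc]
    _ ≤ ∑ _i : Fin d, u ^ 2 * (1 / 2) ^ 2 + u ^ 2 * (d / 2) ^ 2 := by
        gcongr with i
        exact hz i
    _ ≤ (u * (d + 1) / 2) ^ 2 := by
        simp only [sum_const, card_univ, Fintype.card_fin, nsmul_eq_mul]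
        have : (0 : ℝ) ≤ u ^ 2 * d := by positivity
        nlinarith [sq_nonneg u]

lemma log_multinomialPMF_eq (hp : p ∈ simplexInt d) (hn : n ≠ 0) {k : Fin d → ℕ}
    (hk : k ∈ multSupport d n) (hpos : ∀ i, extK d n k i ≠ 0) {x : Fin (d + 1) → ℝ}
    (hx : ∀ i, (extK d n k i : ℝ) = n * extP d p i * (1 + x i)) :
    Real.log (multinomialPMF d n p k) - (Real.log (gaussConst d n p) -
        gaussNorm d n p (castK d k - (n : ℝ) • p) ^ 2 / 2) =
      -∑ i, n * extP d p i * ((1 + x i) * Real.log (1 + x i) - x i - x i ^ 2 / 2) -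
        (∑ i, Real.log (1 + x i)) / 2 + stirlingErr n - ∑ i, stirlingErr (extK d n k i) := by
  have hn' : (0 : ℝ) < n := by positivity
  have hq := extP_pos hp
  have hK : ∀ i, (0 : ℝ) < extK d n k i := fun i => by have := hpos i; positivity
  have hx1 : ∀ i, 0 < 1 + x i := fun i =>
    pos_of_mul_pos_right ((hx i) ▸ hK i) (mul_pos hn' (hq i)).le
  have hlogK : ∀ i, Real.log (extK d n k i) =
      Real.log n + Real.log (extP d p i) + Real.log (1 + x i) := fun i => by
    rw [hx i, Real.log_mul (mul_pos hn' (hq i)).ne' (hx1 i).ne', Real.log_mul hn'.ne' (hq i).ne']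
  have hsumK : ∑ i, (extK d n k i : ℝ) = n := by exact_mod_cast sum_extK hk
  have hsumx : ∑ i, n * extP d p i * x i = 0 := by
    have : ∑ i, (extK d n k i : ℝ) = ∑ i, (n * extP d p i + n * extP d p i * x i) :=
      sum_congr rfl fun i _ => by rw [hx i]; ring
    rw [hsumK, sum_add_distrib, ← mul_sum, sum_extP] at this
    linarith
  have hN : gaussNorm d n p (castK d k - (n : ℝ) • p) ^ 2 = ∑ i, n * extP d p i * x i ^ 2 := by
    rw [gaussNorm_sq hp]
    refine sum_congr rfl fun i _ => ?_
    have := (mul_pos hn' (hq i)).ne'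
    rw [centExt_castK_sub p hk, hx i]
    field_simp
    ring
  have hfact : ∀ m : ℕ, Real.log m.factorial =
      stirlingErr m + (m * Real.log m - m + 1 / 2 * Real.log (2 * π * m)) := fun m => by
    rw [stirlingErr]; ring
  have hpmf : Real.log (multinomialPMF d n p k) = Real.log n.factorial -
      ∑ i, Real.log (extK d n k i).factorial + ∑ i, extK d n k i * Real.log (extP d p i) := by
    have h1 : (∏ i, ((extK d n k i).factorial : ℝ)) ≠ 0 := by positivity
    have h2 : (∏ i, extP d p i ^ extK d n k i) ≠ 0 :=
      (prod_pos fun i _ => pow_pos (hq i) _).ne'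
    rw [multinomialPMF_of_mem p hk, Real.log_mul (by positivity) h2, Real.log_div (by positivity) h1,
      Real.log_prod fun i _ => by positivity, Real.log_prod fun i _ => (pow_pos (hq i) _).ne']
    simp [Real.log_pow]
  have hgc : Real.log (gaussConst d n p) = -(d / 2) * Real.log n -
      (d * Real.log (2 * π) + ∑ i, Real.log (extP d p i)) / 2 := by
    have hprod : 0 < ∏ i, extP d p i := prod_pos fun i _ => hq i
    rw [gaussConst, Real.log_div (by positivity) (by positivity), Real.log_rpow hn',
      Real.log_sqrt (by positivity), Real.log_mul (by positivity) hprod.ne', Real.log_pow,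
      Real.log_prod fun i _ => (hq i).ne']
    ring
  have h2pi : ∀ m : ℕ, m ≠ 0 → Real.log (2 * π * m) = Real.log (2 * π) + Real.log m :=
    fun m hm => Real.log_mul (by positivity) (by positivity)
  have hsum : ∑ i, Real.log (extK d n k i).factorial =
      ∑ i, stirlingErr (extK d n k i) + n * Real.log n + ∑ i, extK d n k i * Real.log (extP d p i) +
        ∑ i, n * extP d p i * ((1 + x i) * Real.log (1 + x i)) - n +
        (d + 1) / 2 * (Real.log (2 * π) + Real.log n) + (∑ i, Real.log (extP d p i)) / 2 +
        (∑ i, Real.log (1 + x i)) / 2 := by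
    have : ∀ i, Real.log (extK d n k i).factorial = stirlingErr (extK d n k i) +
        extK d n k i * Real.log n + extK d n k i * Real.log (extP d p i) +
        n * extP d p i * ((1 + x i) * Real.log (1 + x i)) - extK d n k i +
        1 / 2 * (Real.log (2 * π) + Real.log n) + Real.log (extP d p i) / 2 +
        Real.log (1 + x i) / 2 := fun i => by
      rw [hfact, h2pi _ (hpos i), hlogK i, ← mul_assoc (n * extP d p i), ← hx i]
      ring
    rw [sum_congr rfl fun i _ => this i]
    simp only [sum_add_distrib, sum_sub_distrib, ← sum_mul, ← sum_div, hsumK, sum_const, card_univ,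
      Fintype.card_fin, nsmul_eq_mul]
    push_cast
    ring
  have hexp : ∑ i, n * extP d p i * ((1 + x i) * Real.log (1 + x i) - x i - x i ^ 2 / 2) =
      ∑ i, n * extP d p i * ((1 + x i) * Real.log (1 + x i)) -
        (∑ i, n * extP d p i * x i ^ 2) / 2 := by
    have : ∀ i, n * extP d p i * ((1 + x i) * Real.log (1 + x i) - x i - x i ^ 2 / 2) =
        n * extP d p i * ((1 + x i) * Real.log (1 + x i)) - n * extP d p i * x i -
        n * extP d p i * x i ^ 2 / 2 := fun i => by ring
    rw [sum_congr rfl fun i _ => this i, sum_sub_distrib, sum_sub_distrib, hsumx, sum_div]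
    ring
  rw [hpmf, hgc, hN, hexp, hsum, hfact, h2pi n hn]
  ring

lemma abs_log_multinomialPMF_sub_le (hp : p ∈ simplexInt d) (hn : n ≠ 0) (hu : 0 < u)
    (hpu : ∀ i, 1 ≤ u ^ 2 * (n * extP d p i)) {k : Fin d → ℕ} (hk : k ∈ multSupport d n)
    {r : ℝ} (hr : gaussNorm d n p (castK d k - (n : ℝ) • p) = r) (hur : u * r ≤ 1 / 4) :
    |Real.log (multinomialPMF d n p k) - (Real.log (gaussConst d n p) - r ^ 2 / 2)| ≤
      u * r ^ 3 + u * √(d + 1) * r + u ^ 2 * (d + 1) := by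
  have hn' : (0 : ℝ) < n := by positivity
  set a : Fin (d + 1) → ℝ := fun i => n * extP d p i
  have ha : ∀ i, 0 < a i := fun i => mul_pos hn' (extP_pos hp i)
  set x : Fin (d + 1) → ℝ := fun i => (extK d n k i - a i) / a i with hx_def
  have hxa : ∀ i, |x i| = |centExt d (castK d k - (n : ℝ) • p) i| / a i := fun i => by
    rw [centExt_castK_sub p hk, hx_def, abs_div, abs_of_pos (ha i)]
  have hxr : ∀ i, |x i| ≤ u * r := fun i => by
    rw [hxa, div_le_iff₀ (ha i), ← hr]
    exact abs_centExt_le hp hu hpu _ i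
  have hKx : ∀ i, (extK d n k i : ℝ) = n * extP d p i * (1 + x i) := fun i => by
    have := (ha i).ne'
    change _ = a i * (1 + (extK d n k i - a i) / a i)
    field_simp
    ring
  have hx4 : ∀ i, |x i| ≤ 1 / 4 := fun i => (hxr i).trans hur
  have hK : ∀ i, 3 / 4 * a i ≤ extK d n k i := fun i => by
    rw [hKx]
    nlinarith [ha i, neg_le_of_abs_le (hx4 i)]
  have hpos : ∀ i, extK d n k i ≠ 0 := fun i h => by
    have := hK i
    rw [h] at this
    push_cast at this
    linarith [ha i]
  rw [← hr, log_multinomialPMF_eq hp hn hk hpos hKx, hr]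
  have t1 : |∑ i, a i * ((1 + x i) * Real.log (1 + x i) - x i - x i ^ 2 / 2)| ≤ u * r ^ 3 := by
    calc _ ≤ ∑ i, |a i * ((1 + x i) * Real.log (1 + x i) - x i - x i ^ 2 / 2)| :=
          abs_sum_le_sum_abs _ _
      _ ≤ ∑ i, u * r * (a i * x i ^ 2) := sum_le_sum fun i _ => by
          rw [abs_mul, abs_of_pos (ha i)]
          have h1 := abs_entropy_sub_le (hx4 i)
          have h2 : |x i| ^ 3 ≤ u * r * x i ^ 2 := by
            rw [pow_succ', sq_abs]
            exact mul_le_mul_of_nonneg_right (hxr i) (sq_nonneg _)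
          nlinarith [mul_le_mul_of_nonneg_left (h1.trans h2) (ha i).le]
      _ = u * r ^ 3 := by
          rw [← mul_sum]
          have : ∑ i, a i * x i ^ 2 = r ^ 2 := by
            rw [← hr, gaussNorm_sq hp]
            refine sum_congr rfl fun i _ => ?_
            rw [← sq_abs (x i), hxa, div_pow, sq_abs]
            have := (ha i).ne'
            change _ = _ / a i
            field_simp
          rw [this]
          ring
  have t2 : |∑ i, Real.log (1 + x i)| ≤ 2 * (u * √(d + 1) * r) := by
    calc _ ≤ ∑ i, |Real.log (1 + x i)| := abs_sum_le_sum_abs _ _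
      _ ≤ ∑ i, 2 * |x i| := sum_le_sum fun i _ => abs_log_one_add_le ((hx4 i).trans (by norm_num))
      _ ≤ _ := by
          rw [← mul_sum, sum_congr rfl fun i _ => hxa i, ← hr]
          exact mul_le_mul_of_nonneg_left (sum_abs_centExt_div_le hp hn hu hpu _) zero_le_two
  have t3 : ∀ i, stirlingErr (extK d n k i) ≤ u ^ 2 := fun i => by
    refine (stirlingErr_le (hpos i)).trans ?_
    have h1 := hK i
    have h2 := hpu i
    rw [div_le_iff₀ (by linarith [ha i])]
    nlinarith [sq_nonneg u, mul_le_mul_of_nonneg_left h1 (sq_nonneg u)]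
  have t4 : stirlingErr n ≤ u ^ 2 := by
    refine (stirlingErr_le hn).trans ?_
    have h2 := hpu 0
    have h3 : extP d p 0 ≤ 1 := by
      rw [← sum_extP d p]
      exact single_le_sum (fun i _ => (extP_pos hp i).le) (mem_univ 0)
    rw [div_le_iff₀ (by positivity)]
    nlinarith [mul_le_mul_of_nonneg_left h3 (mul_nonneg (sq_nonneg u) hn'.le),
      mul_nonneg (sq_nonneg u) hn'.le]
  have t5 : ∑ i, stirlingErr (extK d n k i) ≤ u ^ 2 * (d + 1) := by
    refine (sum_le_sum fun i _ => t3 i).trans_eq ?_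
    simp
    ring
  have t6 : 0 ≤ ∑ i, stirlingErr (extK d n k i) := sum_nonneg fun i _ => stirlingErr_nonneg (hpos i)
  have t7 := stirlingErr_nonneg hn
  have t8 : u ^ 2 ≤ u ^ 2 * (d + 1) := by
    have : (0 : ℝ) ≤ u ^ 2 * d := by positivity
    linarith
  rw [abs_le] at t1 t2 ⊢
  constructor <;> linarith [t1.1, t1.2, t2.1, t2.2]

end Scale

/-- The half-open unit cube centred at the integer point `k`. -/
def unitBox (d : ℕ) (k : Fin d → ℕ) : Set (Fin d → ℝ) :=
  Set.univ.pi fun i => Set.Ico ((k i : ℝ) - 1 / 2) (k i + 1 / 2)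

lemma measurableSet_unitBox (d : ℕ) (k : Fin d → ℕ) : MeasurableSet (unitBox d k) :=
  MeasurableSet.univ_pi fun _ => measurableSet_Ico

lemma volume_unitBox (d : ℕ) (k : Fin d → ℕ) : volume (unitBox d k) = 1 := by
  rw [unitBox, Real.volume_pi_Ico]
  refine prod_eq_one fun i _ => ?_
  norm_num

lemma abs_sub_castK_le {d : ℕ} {k : Fin d → ℕ} {y : Fin d → ℝ} (hy : y ∈ unitBox d k)
    (i : Fin d) : |(y - castK d k) i| ≤ 1 / 2 := by
  have h := hy i (Set.mem_univ i)
  rw [Set.mem_Ico] at h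
  rw [Pi.sub_apply, castK, abs_le]
  constructor <;> linarith

lemma pairwise_disjoint_unitBox (d : ℕ) : Pairwise (Function.onFun Disjoint (unitBox d)) := by
  intro k l hkl
  refine Set.disjoint_left.2 fun y hk hl => hkl (funext fun i => ?_)
  have h1 := hk i (Set.mem_univ i)
  have h2 := hl i (Set.mem_univ i)
  rw [Set.mem_Ico] at h1 h2
  have a1 : (k i : ℝ) < l i + 1 := by linarith
  have a2 : (l i : ℝ) < k i + 1 := by linarith
  norm_cast at a1 a2
  omega

namespace IsGaussianDensity

variable {d : ℕ} {N : Seminorm ℝ (Fin d → ℝ)} {C : ℝ}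

lemma setIntegral_sub_right (c : Fin d → ℝ) (r : ℝ) :
    ∫ y in {y | N (y - c) ≤ r}, C * Real.exp (-(N (y - c)) ^ 2 / 2) = ballMass N C r :=
  (measurePreserving_sub_right volume c).setIntegral_preimage_emb (measurableEmbedding_subRight c)
    (fun z => C * Real.exp (-(N z) ^ 2 / 2)) {z | N z ≤ r}

lemma abs_sub_le_of_mem_unitBox {η : ℝ} (hη : ∀ z : Fin d → ℝ, (∀ i, |z i| ≤ 1 / 2) → N z ≤ η)
    (c : Fin d → ℝ) {k : Fin d → ℕ} {y : Fin d → ℝ} (hy : y ∈ unitBox d k) :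
    |N (y - c) - N (castK d k - c)| ≤ η := by
  refine (abs_sub_map_le_sub N _ _).trans ?_
  rw [sub_sub_sub_cancel_right]
  exact hη _ (abs_sub_castK_le hy)

lemma density_le_of_mem_unitBox (h : IsGaussianDensity N C) {η t : ℝ} (hη2 : η ≤ 2)
    (hη : ∀ z : Fin d → ℝ, (∀ i, |z i| ≤ 1 / 2) → N z ≤ η) (c : Fin d → ℝ) {k : Fin d → ℕ}
    (hk : N (castK d k - c) ≤ t) {y : Fin d → ℝ} (hy : y ∈ unitBox d k) :
    C * Real.exp (-(N (castK d k - c)) ^ 2 / 2) ≤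
        Real.exp (η * (t + 1)) * (C * Real.exp (-(N (y - c)) ^ 2 / 2)) ∧
      C * Real.exp (-(N (y - c)) ^ 2 / 2) ≤
        Real.exp (η * (t + 1)) * (C * Real.exp (-(N (castK d k - c)) ^ 2 / 2)) := by
  have h1 := abs_sub_le_of_mem_unitBox hη c hy
  have hC := h.nonneg
  have hN1 := apply_nonneg N (castK d k - c)
  set a := N (castK d k - c)
  set b := N (y - c)
  rw [abs_le] at h1
  have key : |b ^ 2 - a ^ 2| ≤ 2 * (η * (t + 1)) := by
    rw [abs_le]
    constructor <;> nlinarith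
  rw [abs_le] at key
  rw [mul_left_comm, mul_left_comm (Real.exp _), ← Real.exp_add, ← Real.exp_add]
  constructor <;> gcongr <;> linarith

lemma sum_le_of_le_density (h : IsGaussianDensity N C) {η t r M : ℝ} (hη2 : η ≤ 2) (hM : 0 ≤ M)
    (hη : ∀ z : Fin d → ℝ, (∀ i, |z i| ≤ 1 / 2) → N z ≤ η) (c : Fin d → ℝ)
    {T : Finset (Fin d → ℕ)} (ht : ∀ k ∈ T, N (castK d k - c) ≤ t)
    (hr : ∀ k ∈ T, N (castK d k - c) + η ≤ r) {w : (Fin d → ℕ) → ℝ}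
    (hw : ∀ k ∈ T, w k ≤ M * (C * Real.exp (-(N (castK d k - c)) ^ 2 / 2))) :
    ∑ k ∈ T, w k ≤ M * Real.exp (η * (t + 1)) * ballMass N C r := by
  set g : (Fin d → ℝ) → ℝ := fun y => C * Real.exp (-(N (y - c)) ^ 2 / 2)
  have hgi : Integrable g := h.integrable.comp_sub_right c
  have hM' : 0 ≤ M * Real.exp (η * (t + 1)) := by positivity
  calc ∑ k ∈ T, w k ≤ ∑ k ∈ T, ∫ y in unitBox d k, M * Real.exp (η * (t + 1)) * g y := by
        refine sum_le_sum fun k hk => ?_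
        have e : w k = ∫ _ in unitBox d k, w k := by
          rw [setIntegral_const, Measure.real, volume_unitBox]
          simp
        rw [e]
        refine setIntegral_mono_on (integrableOn_const (by simp [volume_unitBox]))
          (hgi.const_mul _).integrableOn (measurableSet_unitBox d k) fun y hy => ?_
        refine (hw k hk).trans ?_
        rw [mul_assoc]
        exact mul_le_mul_of_nonneg_left (h.density_le_of_mem_unitBox hη2 hη c (ht k hk) hy).1 hM
    _ = ∫ y in ⋃ k ∈ T, unitBox d k, M * Real.exp (η * (t + 1)) * g y :=
        (integral_biUnion_finset T (fun k _ => measurableSet_unitBox d k)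
          ((pairwise_disjoint_unitBox d).set_pairwise _)
          fun k _ => (hgi.const_mul _).integrableOn).symm
    _ ≤ ∫ y in {y | N (y - c) ≤ r}, M * Real.exp (η * (t + 1)) * g y := by
        refine setIntegral_mono_set (hgi.const_mul _).integrableOn
          (.of_forall fun y => mul_nonneg hM' (h.density_nonneg _))
          (Filter.Eventually.of_forall fun y hy => ?_)
        obtain ⟨k, hk, hyk⟩ := Set.mem_iUnion₂.1 hy
        have h1 := (abs_le.1 (abs_sub_le_of_mem_unitBox hη c hyk)).2
        have h2 := hr k hk
        change N (y - c) ≤ r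
        linarith
    _ = _ := by rw [integral_const_mul, setIntegral_sub_right]

lemma ballMass_le_sum (h : IsGaussianDensity N C) {η t r M : ℝ} (hη2 : η ≤ 2)
    (hη : ∀ z : Fin d → ℝ, (∀ i, |z i| ≤ 1 / 2) → N z ≤ η) (c : Fin d → ℝ)
    {T : Finset (Fin d → ℕ)} (ht : ∀ k ∈ T, N (castK d k - c) ≤ t)
    (hr : ∀ y : Fin d → ℝ, N (y - c) ≤ r → ∃ k ∈ T, y ∈ unitBox d k) {w : (Fin d → ℕ) → ℝ}
    (hw : ∀ k ∈ T, C * Real.exp (-(N (castK d k - c)) ^ 2 / 2) ≤ M * w k) :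
    ballMass N C r ≤ M * Real.exp (η * (t + 1)) * ∑ k ∈ T, w k := by
  set g : (Fin d → ℝ) → ℝ := fun y => C * Real.exp (-(N (y - c)) ^ 2 / 2)
  have hgi : Integrable g := h.integrable.comp_sub_right c
  calc ballMass N C r = ∫ y in {y | N (y - c) ≤ r}, g y := (setIntegral_sub_right c r).symm
    _ ≤ ∫ y in ⋃ k ∈ T, unitBox d k, g y := by
        refine setIntegral_mono_set hgi.integrableOn (.of_forall fun y => h.density_nonneg _)
          (Filter.Eventually.of_forall fun y hy => ?_)
        obtain ⟨k, hk, hyk⟩ := hr y hy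
        exact Set.mem_iUnion₂.2 ⟨k, hk, hyk⟩
    _ = ∑ k ∈ T, ∫ y in unitBox d k, g y :=
        integral_biUnion_finset T (fun k _ => measurableSet_unitBox d k)
          ((pairwise_disjoint_unitBox d).set_pairwise _) fun k _ => hgi.integrableOn
    _ ≤ ∑ k ∈ T, M * Real.exp (η * (t + 1)) * w k := by
        refine sum_le_sum fun k hk => ?_
        have e : M * Real.exp (η * (t + 1)) * w k =
            ∫ _ in unitBox d k, M * Real.exp (η * (t + 1)) * w k := by
          rw [setIntegral_const, Measure.real, volume_unitBox]
          simp
        rw [e]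
        refine setIntegral_mono_on hgi.integrableOn (integrableOn_const (by simp [volume_unitBox]))
          (measurableSet_unitBox d k) fun y hy => ?_
        refine (h.density_le_of_mem_unitBox hη2 hη c (ht k hk) hy).2.trans ?_
        rw [mul_right_comm, mul_comm (M * w k)]
        exact mul_le_mul_of_nonneg_left (hw k hk) (Real.exp_pos _).le
    _ = _ := by rw [mul_sum]

end IsGaussianDensity

section Comparison

variable {d n : ℕ} {p : Fin d → ℝ} {u S : ℝ}

lemma gaussNorm_le_of_multinomialPMF_le (hp : p ∈ simplexInt d) (hn : n ≠ 0) (hu : 0 < u)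
    (hpu : ∀ i, 1 ≤ u ^ 2 * (n * extP d p i)) (huS : u * S ≤ 1 / 4) {k m : Fin d → ℕ}
    (hk : k ∈ multSupport d n) (hm : m ∈ multSupport d n)
    (hkS : gaussNorm d n p (castK d k - (n : ℝ) • p) ≤ S)
    (hmk : multinomialPMF d n p m ≤ multinomialPMF d n p k) :
    gaussNorm d n p (castK d k - (n : ℝ) • p) ≤ gaussNorm d n p (castK d m - (n : ℝ) • p) +
      (4 * u * S ^ 2 + 8 * u * √(d + 1)) := by
  have ha0 := apply_nonneg (gaussNorm d n p) (castK d k - (n : ℝ) • p)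
  have hb0 := apply_nonneg (gaussNorm d n p) (castK d m - (n : ℝ) • p)
  set a := gaussNorm d n p (castK d k - (n : ℝ) • p) with ha
  set b := gaussNorm d n p (castK d m - (n : ℝ) • p) with hb
  have hq0 : 0 ≤ √((d : ℝ) + 1) := Real.sqrt_nonneg _
  have hq2 : √((d : ℝ) + 1) ^ 2 = d + 1 := Real.sq_sqrt (by positivity)
  set q := √((d : ℝ) + 1)
  have huS2 : 0 ≤ u * S ^ 2 := by positivity
  have huq : 0 ≤ u * q := by positivity
  rcases le_total a b with hab | hab
  · linarith
  rcases le_total a (u * q) with haq | haq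
  · linarith
  have h1 := abs_log_multinomialPMF_sub_le hp hn hu hpu hk ha.symm
    ((mul_le_mul_of_nonneg_left hkS hu.le).trans huS)
  have h2 := abs_log_multinomialPMF_sub_le hp hn hu hpu hm hb.symm
    ((mul_le_mul_of_nonneg_left (hab.trans hkS) hu.le).trans huS)
  have h3 := Real.log_le_log (multinomialPMF_pos hp hm) hmk
  rw [← hq2, Real.sqrt_sq hq0] at h1 h2
  rw [abs_le] at h1 h2
  have h4 : u * b ^ 3 + u * q * b + u ^ 2 * q ^ 2 ≤ u * a ^ 3 + u * q * a + u ^ 2 * q ^ 2 := by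
    gcongr
  have h7 : u * a ^ 3 ≤ u * S ^ 2 * a := by
    have : a ^ 2 ≤ S ^ 2 := by gcongr
    nlinarith [mul_le_mul_of_nonneg_left this (mul_nonneg hu.le ha0)]
  rcases ha0.eq_or_lt with h0 | h0
  · linarith
  refine le_of_mul_le_mul_right ?_ h0
  nlinarith

lemma multinomialPMF_le_density (hp : p ∈ simplexInt d) (hn : n ≠ 0) (hu : 0 < u)
    (hpu : ∀ i, 1 ≤ u ^ 2 * (n * extP d p i)) (huS : u * S ≤ 1 / 4) {k : Fin d → ℕ}
    (hk : k ∈ multSupport d n)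
    (hkS : gaussNorm d n p (castK d k - (n : ℝ) • p) ≤ S) :
    multinomialPMF d n p k ≤ Real.exp (u * S ^ 3 + u * √(d + 1) * S + u ^ 2 * (d + 1)) *
        (gaussConst d n p * Real.exp (-(gaussNorm d n p (castK d k - (n : ℝ) • p)) ^ 2 / 2)) ∧
      gaussConst d n p * Real.exp (-(gaussNorm d n p (castK d k - (n : ℝ) • p)) ^ 2 / 2) ≤
        Real.exp (u * S ^ 3 + u * √(d + 1) * S + u ^ 2 * (d + 1)) * multinomialPMF d n p k := by
  have h1 := abs_log_multinomialPMF_sub_le hp hn hu hpu hk rfl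
    ((mul_le_mul_of_nonneg_left hkS hu.le).trans huS)
  set a := gaussNorm d n p (castK d k - (n : ℝ) • p)
  have h2 : u * a ^ 3 + u * √(d + 1) * a + u ^ 2 * (d + 1) ≤
      u * S ^ 3 + u * √(d + 1) * S + u ^ 2 * (d + 1) := by gcongr
  have h3 := abs_le.1 (h1.trans h2)
  set ε := u * S ^ 3 + u * √(d + 1) * S + u ^ 2 * (d + 1)
  have hC := gaussConst_pos hn hp
  have hP := multinomialPMF_pos hp hk
  have e1 : gaussConst d n p * Real.exp (-a ^ 2 / 2) =
      Real.exp (Real.log (gaussConst d n p) - a ^ 2 / 2) := by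
    rw [sub_eq_add_neg, Real.exp_add, Real.exp_log hC, neg_div]
  have e2 : multinomialPMF d n p k = Real.exp (Real.log (multinomialPMF d n p k)) :=
    (Real.exp_log hP).symm
  rw [e1, e2, ← Real.exp_add, ← Real.exp_add, Real.exp_le_exp, Real.exp_le_exp]
  constructor <;> linarith [h3.1, h3.2]

lemma exists_mem_unitBox (hp : p ∈ simplexInt d) (hu : 0 < u)
    (hpu : ∀ i, 1 ≤ u ^ 2 * (n * extP d p i)) (huS : u * S ≤ 1 / 4)
    (hud : u ^ 2 * (d + 1) ≤ 1) {y : Fin d → ℝ} (hy : gaussNorm d n p (y - (n : ℝ) • p) ≤ S) :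
    ∃ k ∈ multSupport d n, y ∈ unitBox d k := by
  have ha0 : ∀ i, 0 ≤ n * extP d p i := fun i => mul_nonneg n.cast_nonneg (extP_pos hp i).le
  have hc : ∀ i, -(n * extP d p i) / 4 ≤ centExt d (y - (n : ℝ) • p) i := fun i => by
    have h1 := neg_le_of_abs_le (abs_centExt_le hp hu hpu (y - (n : ℝ) • p) i)
    have h2 : u * gaussNorm d n p (y - (n : ℝ) • p) ≤ 1 / 4 :=
      (mul_le_mul_of_nonneg_left hy hu.le).trans huS
    nlinarith [ha0 i]
  have hy0 : ∀ i, 0 ≤ y i := fun i => by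
    have h1 := hc i.castSucc
    have h2 := ha0 i.castSucc
    simp only [centExt_castSucc, extP_castSucc, Pi.sub_apply, Pi.smul_apply, smul_eq_mul] at h1 h2
    linarith
  have hys : ∑ i, y i + d / 2 ≤ n := by
    have h1 := hc (Fin.last d)
    have h2 := hpu (Fin.last d)
    simp only [centExt_last, extP_last, Pi.sub_apply, Pi.smul_apply, smul_eq_mul,
      sum_sub_distrib, ← mul_sum] at h1 h2
    have h3 : ((d : ℝ) + 1) ≤ n * (1 - ∑ i, p i) := by
      refine le_of_mul_le_mul_left (hud.trans h2) (by positivity)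
    have : (0 : ℝ) ≤ d := d.cast_nonneg
    linarith
  have hmem : y ∈ unitBox d fun i => ⌊y i + 1 / 2⌋₊ := fun i _ => by
    have h1 := Nat.floor_le (a := y i + 1 / 2) (by linarith [hy0 i])
    have h2 := Nat.lt_floor_add_one (y i + 1 / 2)
    constructor <;> linarith
  refine ⟨_, mem_multSupport.2 ?_, hmem⟩
  have h : ((∑ i, ⌊y i + 1 / 2⌋₊ : ℕ) : ℝ) ≤ n := by
    push_cast
    refine (sum_le_sum fun i _ => Nat.floor_le (a := y i + 1 / 2) (by linarith [hy0 i])).trans ?_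
    rw [sum_add_distrib]
    simp only [sum_const, card_univ, Fintype.card_fin, nsmul_eq_mul]
    linarith
  exact_mod_cast h

lemma confSum_le_ballMass (hp : p ∈ simplexInt d) (hn : n ≠ 0) (hu : 0 < u)
    (hpu : ∀ i, 1 ≤ u ^ 2 * (n * extP d p i)) (huS : u * S ≤ 1 / 4) (hud : u * (d + 1) / 2 ≤ 2)
    {A : ℝ} (hA0 : 0 < A) (hA : ∀ i, 100 * A ≤ n * extP d p i) (hAS : 9 / 2 * A ≤ S ^ 2)
    (hS : 0 ≤ S) {m : Fin d → ℕ} (hm : m ∈ multSupport d n) :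
    confSum d n p m ≤ Real.exp (u * S ^ 3 + u * √(d + 1) * S + u ^ 2 * (d + 1) +
        u * (d + 1) / 2 * (S + 1)) * ballMass (gaussNorm d n p) (gaussConst d n p)
          (gaussNorm d n p (castK d m - (n : ℝ) • p) +
            (4 * u * S ^ 2 + 8 * u * √(d + 1)) + u * (d + 1) / 2) +
      ((n : ℝ) + 1) ^ d * Real.exp (-A) := by
  have hG := isGaussianDensity_gaussNorm hn hp
  rw [confSum_eq, ← sum_filter_add_sum_filter_not _ fun k => hellSq d n p k ≤ A]
  refine add_le_add ?_ ?_
  · have hkS : ∀ k ∈ ({k ∈ multSupport d n | multinomialPMF d n p m ≤ multinomialPMF d n p k} :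
        Finset (Fin d → ℕ)).filter (fun k => hellSq d n p k ≤ A),
        gaussNorm d n p (castK d k - (n : ℝ) • p) ≤ S := fun k hk => by
      simp only [mem_filter] at hk
      exact le_of_sq_le_sq ((gaussNorm_sq_le_of_hellSq_le hp hk.1.1 hA hA0 hk.2).trans hAS) hS
    rw [Real.exp_add]
    refine hG.sum_le_of_le_density hud (Real.exp_pos _).le
      (fun z hz => gaussNorm_le_of_abs_le hp hn hu hpu hz) ((n : ℝ) • p) hkS
      (fun k hk => ?_) fun k hk => ?_
    · have h := hkS k hk
      simp only [mem_filter] at hk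
      gcongr
      exact gaussNorm_le_of_multinomialPMF_le hp hn hu hpu huS hk.1.1 hm h hk.1.2
    · have h := hkS k hk
      simp only [mem_filter] at hk
      exact (multinomialPMF_le_density hp hn hu hpu huS hk.1.1 h).1
  · refine le_trans (sum_le_sum_of_subset_of_nonneg ?_ fun k _ _ => multinomialPMF_nonneg hp k)
      (sum_multinomialPMF_far_le hn hp A)
    intro k hk
    simp only [mem_filter, not_le] at hk ⊢
    exact ⟨hk.1.1, hk.2⟩

lemma ballMass_le_confSum (hp : p ∈ simplexInt d) (hn : n ≠ 0) (hu : 0 < u)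
    (hpu : ∀ i, 1 ≤ u ^ 2 * (n * extP d p i)) (huS : u * S ≤ 1 / 4) (hud : u * (d + 1) / 2 ≤ 2)
    (hud2 : u ^ 2 * (d + 1) ≤ 1) {m : Fin d → ℕ} (hm : m ∈ multSupport d n)
    (hmS : gaussNorm d n p (castK d m - (n : ℝ) • p) ≤ S) :
    ballMass (gaussNorm d n p) (gaussConst d n p) (gaussNorm d n p (castK d m - (n : ℝ) • p) -
        (4 * u * S ^ 2 + 8 * u * √(d + 1)) - 2 * (u * (d + 1) / 2)) ≤
      Real.exp (u * S ^ 3 + u * √(d + 1) * S + u ^ 2 * (d + 1) +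
        u * (d + 1) / 2 * (S + 1)) * confSum d n p m := by
  have hG := isGaussianDensity_gaussNorm hn hp
  have hη := fun z hz => gaussNorm_le_of_abs_le (z := z) hp hn hu hpu hz
  have hη0 : 0 < u * (d + 1) / 2 := by positivity
  have hh : 0 ≤ 4 * u * S ^ 2 + 8 * u * √(d + 1) := by positivity
  rw [Real.exp_add]
  have key := hG.ballMass_le_sum (t := S)
    (r := gaussNorm d n p (castK d m - (n : ℝ) • p) -
      (4 * u * S ^ 2 + 8 * u * √(d + 1)) - 2 * (u * (d + 1) / 2))
    (T := {k ∈ multSupport d n | multinomialPMF d n p m ≤ multinomialPMF d n p k ∧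
      gaussNorm d n p (castK d k - (n : ℝ) • p) ≤ S})
    (M := Real.exp (u * S ^ 3 + u * √(d + 1) * S + u ^ 2 * (d + 1)))
    (w := multinomialPMF d n p) hud hη ((n : ℝ) • p)
    (fun k hk => (mem_filter.1 hk).2.2) (fun y hy => ?_) fun k hk => ?_
  · refine key.trans (mul_le_mul_of_nonneg_left ?_ (by positivity))
    rw [confSum_eq]
    refine sum_le_sum_of_subset_of_nonneg ?_ fun k _ _ => multinomialPMF_nonneg hp k
    intro k hk
    simp only [mem_filter] at hk ⊢
    exact ⟨hk.1, hk.2.1⟩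
  · obtain ⟨k, hk, hyk⟩ := exists_mem_unitBox hp hu hpu huS hud2 (y := y) (by linarith)
    have h1 := (abs_le.1 (IsGaussianDensity.abs_sub_le_of_mem_unitBox hη ((n : ℝ) • p) hyk)).1
    refine ⟨k, mem_filter.2 ⟨hk, ?_, by linarith⟩, hyk⟩
    by_contra! hlt
    have := gaussNorm_le_of_multinomialPMF_le hp hn hu hpu huS hm hk hmS hlt.le
    linarith
  · rw [mem_filter] at hk
    exact (multinomialPMF_le_density hp hn hu hpu huS hk.1 hk.2.2).2

end Comparison

lemma pow_mul_exp_neg_log_le (d : ℕ) {n : ℕ} (hn : 2 ≤ n) :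
    ((n : ℝ) + 1) ^ d * Real.exp (-(2 * ((d + 1) * Real.log n))) ≤ 1 / √n := by
  have hn2 : (2 : ℝ) ≤ n := by exact_mod_cast hn
  have hn' : (0 : ℝ) < n := by linarith
  have e : Real.exp (-(2 * ((d + 1) * Real.log n))) = ((n : ℝ) ^ (2 * (d + 1)))⁻¹ := by
    rw [Real.exp_neg, ← mul_assoc]
    congr 1
    rw [mul_comm, show (2 * ((d : ℝ) + 1)) = ((2 * (d + 1) : ℕ) : ℝ) by push_cast; ring,
      ← Real.rpow_natCast, Real.rpow_def_of_pos hn']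
  have h1 : ((n : ℝ) + 1) ^ d ≤ (n ^ 2) ^ d := by gcongr; nlinarith
  have h2 : √n ≤ (n : ℝ) ^ 2 := by
    rw [Real.sqrt_le_left (by positivity)]
    nlinarith [pow_le_pow_left₀ zero_le_two hn2 2, pow_le_pow_left₀ zero_le_two hn2 3]
  rw [e, ← div_eq_mul_inv, div_le_div_iff₀ (by positivity) (by positivity), one_mul, mul_add, mul_one,
    pow_add, pow_mul]
  gcongr

lemma sqrt_two_pow_mul_exp_le (d : ℕ) {n : ℕ} (hn : 2 ≤ n) {t : ℝ}
    (ht : 2 * ((d + 1) * Real.log n) ≤ t) : √2 ^ d * Real.exp (-t / 4) ≤ 1 / √n := by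
  have hn2 : (2 : ℝ) ≤ n := by exact_mod_cast hn
  have hn' : (0 : ℝ) < n := by linarith
  have h : √(n : ℝ) ^ (d + 1) = Real.exp ((d + 1) * Real.log n / 2) := by
    rw [← Real.rpow_natCast, Real.rpow_def_of_pos (by positivity), Real.log_sqrt hn'.le]
    push_cast
    ring_nf
  calc √2 ^ d * Real.exp (-t / 4) ≤ √n ^ d * Real.exp (-((d + 1) * Real.log n / 2)) := by
        gcongr
        linarith
    _ = 1 / √n := by
        rw [Real.exp_neg, ← h, pow_succ]
        field_simp

/-- The local error and the radius shift of the near regime in terms of `u` and `R`. -/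
lemma local_error_le {u R q D : ℝ} (hu : 0 < u) (hR : 1 ≤ R) (hq : q ≤ R)
    (hD0 : 0 ≤ D) (hD : D ≤ R ^ 2) (huR : 33 * (u * R ^ 3) ≤ 1) :
    u * (3 * R) ^ 3 + u * q * (3 * R) + u ^ 2 * D + u * D / 2 * (3 * R + 1) ≤ 33 * (u * R ^ 3) ∧
      4 * u * (3 * R) ^ 2 + 8 * u * q + 2 * (u * D / 2) ≤ 45 * (u * R ^ 2) := by
  have hR0 : 0 < R := by linarith
  have hR2 : R ≤ R ^ 2 := le_self_pow₀ hR two_ne_zero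
  have hR3 : R ^ 2 ≤ R ^ 3 := pow_le_pow_right₀ hR (by norm_num)
  have h1 : u * q * (3 * R) ≤ 3 * (u * R ^ 3) := by
    calc u * q * (3 * R) ≤ u * R * (3 * R) := by gcongr
      _ = 3 * (u * R ^ 2) := by ring
      _ ≤ _ := by gcongr
  have h2 : u ^ 2 * D ≤ u * R ^ 3 := by
    have hu1 : u ≤ 1 := by
      have : u * 1 ≤ u * R ^ 3 := by
        gcongr
        exact one_le_pow₀ hR
      linarith
    calc u ^ 2 * D = u * (u * D) := by ring
      _ ≤ u * (1 * R ^ 3) := by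
          gcongr
          exact hD.trans hR3
      _ = _ := by ring
  have h3 : u * D / 2 * (3 * R + 1) ≤ 2 * (u * R ^ 3) := by
    calc u * D / 2 * (3 * R + 1) ≤ u * R ^ 2 / 2 * (3 * R + R) := by gcongr
      _ = _ := by ring
  have h4 : u * q ≤ u * R ^ 2 := by
    gcongr
    exact hq.trans hR2
  have h5 : u * D ≤ u * R ^ 2 := by gcongr
  constructor <;> linarith

section Near

variable {d n : ℕ} {p : Fin d → ℝ} {u R : ℝ}

lemma abs_confSum_sub_ballMass_le (hd : d ≠ 0) (hp : p ∈ simplexInt d) (hn : n ≠ 0) (hu : 0 < u)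
    (hpu : ∀ i, 1 ≤ u ^ 2 * (n * extP d p i)) (hR : 1 ≤ R) (hdR : (d : ℝ) + 1 ≤ R ^ 2)
    (huR : 33 * (u * R ^ 3) ≤ 1) {m : Fin d → ℕ} (hm : m ∈ multSupport d n)
    (hmA : hellSq d n p m ≤ 2 * R ^ 2) :
    |confSum d n p m - ballMass (gaussNorm d n p) (gaussConst d n p)
        (gaussNorm d n p (castK d m - (n : ℝ) • p))| ≤
      66 * (u * R ^ 3) + 180 * (u * (d + 1) * R ^ 2) +
        ((n : ℝ) + 1) ^ d * Real.exp (-(2 * R ^ 2)) := by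
  have hR0 : 0 < R := by linarith
  have hR2 : R ≤ R ^ 2 := by nlinarith
  have hR3 : R ^ 2 ≤ R ^ 3 := by nlinarith [sq_nonneg R]
  have huR3 : u * R ^ 2 ≤ u * R ^ 3 := by gcongr
  have huR2 : u * R ≤ u * R ^ 2 := by gcongr
  have huR1 : u ≤ u * R := by nlinarith
  have huS : u * (3 * R) ≤ 1 / 4 := by linarith
  have hD0 : (0 : ℝ) < d + 1 := by positivity
  have hudR : u * (d + 1) ≤ u * R ^ 2 := by gcongr
  have hud : u * (d + 1) / 2 ≤ 2 := by linarith
  have hu2d : u ^ 2 * (d + 1) ≤ u * R ^ 3 := by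
    have : u * (u * (d + 1)) ≤ 1 * (u * (d + 1)) := by gcongr; linarith
    nlinarith
  have hq : √((d : ℝ) + 1) ≤ R := by
    rw [Real.sqrt_le_left hR0.le]; exact hdR
  have hA : ∀ i, 100 * (2 * R ^ 2) ≤ n * extP d p i := fun i => by
    have h1 := hpu i
    have h2 : (u * R) ^ 2 ≤ (1 / 33) ^ 2 := by gcongr; linarith
    have h3 : 0 < u ^ 2 := by positivity
    refine le_of_mul_le_mul_left (le_trans ?_ h1) h3
    nlinarith
  have hAS : 9 / 2 * (2 * R ^ 2) ≤ (3 * R) ^ 2 := by nlinarith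
  have hmS : gaussNorm d n p (castK d m - (n : ℝ) • p) ≤ 3 * R :=
    le_of_sq_le_sq ((gaussNorm_sq_le_of_hellSq_le hp hm hA (by positivity) hmA).trans hAS)
      (by positivity)
  have hup := confSum_le_ballMass hp hn hu hpu huS hud (by positivity) hA hAS (by positivity) hm
  have hlo := ballMass_le_confSum hp hn hu hpu huS hud (by linarith) hm hmS
  obtain ⟨hε1, hw⟩ := local_error_le hu hR hq hD0.le hdR huR
  have hG := isGaussianDensity_gaussNorm hn hp
  set N := gaussNorm d n p
  set C := gaussConst d n p
  have hs := apply_nonneg N (castK d m - (n : ℝ) • p)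
  set s := N (castK d m - (n : ℝ) • p)
  set tail := ((n : ℝ) + 1) ^ d * Real.exp (-(2 * R ^ 2))
  have htail : 0 ≤ tail := by positivity
  set η := u * (d + 1) / 2
  have hη0 : 0 < η := by positivity
  set h₁ := 4 * u * (3 * R) ^ 2 + 8 * u * √(d + 1)
  have hh₁0 : 0 ≤ h₁ := by positivity
  set ε := u * (3 * R) ^ 3 + u * √(d + 1) * (3 * R) + u ^ 2 * (d + 1) + η * (3 * R + 1)
  have hε0 : 0 ≤ ε := by positivity
  have hexp : Real.exp ε - 1 ≤ 2 * ε := by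
    have := Real.abs_exp_sub_one_le (x := ε) (by rw [abs_of_nonneg hε0]; linarith)
    rw [abs_of_nonneg hε0] at this
    exact (le_abs_self _).trans this
  have hDw : 4 * (d + 1) * (h₁ + 2 * η) ≤ 180 * (u * (d + 1) * R ^ 2) := by
    have := mul_le_mul_of_nonneg_left hw (by positivity : (0 : ℝ) ≤ 4 * (d + 1))
    nlinarith
  rw [abs_le]
  constructor
  · have h1 := confSum_le_one (n := n) hp m
    have h0 := confSum_nonneg (n := n) hp m
    have h2 : ballMass N C s - ballMass N C (s - h₁ - 2 * η) ≤ 4 * (d + 1) * (h₁ + 2 * η) := by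
      rcases le_total 0 (s - h₁ - 2 * η) with h3 | h3
      · refine (hG.ballMass_sub_le hd h3 (by linarith)).trans_eq ?_
        ring
      · have h4 := hG.ballMass_le hd hs
        have h5 := hG.ballMass_nonneg (s - h₁ - 2 * η)
        nlinarith
    have h3 : Real.exp ε * confSum d n p m ≤ confSum d n p m + 2 * ε := by
      have : (Real.exp ε - 1) * confSum d n p m ≤ 2 * ε * 1 := by gcongr
      linarith
    linarith
  · have h1 := hG.ballMass_le_one (s + h₁ + η)
    have h0 := hG.ballMass_nonneg (s + h₁ + η)
    have h2 := hG.ballMass_sub_le hd hs (by linarith : s ≤ s + h₁ + η)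
    have h3 : Real.exp ε * ballMass N C (s + h₁ + η) ≤ ballMass N C (s + h₁ + η) + 2 * ε := by
      have : (Real.exp ε - 1) * ballMass N C (s + h₁ + η) ≤ 2 * ε * 1 := by gcongr
      linarith
    have h4 : 4 * (d + 1) * (s + h₁ + η - s) ≤ 4 * ((d : ℝ) + 1) * (h₁ + 2 * η) := by
      gcongr
      linarith
    linarith

end Near

/-- If the cell count is at least `b` and the Hellinger distance is small, then the expected cell
count is at least `b / 2`. -/
lemma half_le_of_hellSq_le {d n : ℕ} {p : Fin d → ℝ} (hp : p ∈ simplexInt d) {m : Fin d → ℕ}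
    {b : ℝ} (hb : 0 < b) (hmb : ∀ i, b ≤ extK d n m i) (hA : hellSq d n p m ≤ b / 100)
    (i : Fin (d + 1)) : b / 2 ≤ n * extP d p i := by
  by_contra! hlt
  have ha : 0 ≤ n * extP d p i := mul_nonneg n.cast_nonneg (extP_pos hp i).le
  have hi : (√(extK d n m i) - √(n * extP d p i)) ^ 2 ≤ b / 100 :=
    (single_le_sum (f := fun i => (√(extK d n m i) - √(n * extP d p i)) ^ 2)
      (fun _ _ => sq_nonneg _) (mem_univ i)).trans hA
  have hsb : √b ^ 2 = b := Real.sq_sqrt hb.le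
  have h1 : √b ≤ √(extK d n m i) := Real.sqrt_le_sqrt (hmb i)
  have h2 : √(n * extP d p i) ≤ 3 / 4 * √b := by
    refine le_of_sq_le_sq ?_ (by positivity)
    rw [Real.sq_sqrt ha, mul_pow, hsb]
    linarith
  have h3 : (1 / 4 * √b) ^ 2 ≤ (√(extK d n m i) - √(n * extP d p i)) ^ 2 := by
    gcongr
    linarith
  rw [mul_pow, hsb] at h3
  linarith

lemma div_le_extK_of_mem_Ptau {d n : ℕ} {τ : ℝ} (hτ : 0 < τ) (hn : n ≠ 0) {m : Fin d → ℕ}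
    (hm : m ∈ multSupport d n) (h : (fun i => (m i : ℝ) / n) ∈ Ptau d τ) (i : Fin (d + 1)) :
    n / τ ≤ extK d n m i := by
  have hn' : (0 : ℝ) < n := by positivity
  have e : extP d (fun i => (m i : ℝ) / n) i = extK d n m i / n := by
    refine Fin.lastCases ?_ (fun j => ?_) i
    · rw [extP_last, extK_last, Nat.cast_sub (mem_multSupport.1 hm), ← sum_div]
      push_cast
      field_simp
    · rw [extP_castSucc, extK_castSucc]
  have h1 := h.2 i
  have h2 := extP_pos h.1 i
  rw [e] at h1 h2
  rw [inv_le_comm₀ h2 hτ, le_div_iff₀ hn'] at h1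
  rwa [div_eq_inv_mul]

lemma abs_confSum_sub_ballMass_le_of_lt_hellSq {d n : ℕ} (hn : 2 ≤ n) {p : Fin d → ℝ}
    (hp : p ∈ simplexInt d) {m : Fin d → ℕ} (hm : m ∈ multSupport d n)
    (hmA : 2 * ((d + 1) * Real.log n) ≤ hellSq d n p m) :
    |confSum d n p m - ballMass (gaussNorm d n p) (gaussConst d n p)
        (gaussNorm d n p (castK d m - (n : ℝ) • p))| ≤ 1 / √n := by
  have hn0 : n ≠ 0 := by omega
  have hG := isGaussianDensity_gaussNorm hn0 hp
  have h1 := one_sub_confSum_le p m (Real.exp_pos _).le ((multinomialPMF_le_exp hn0 hp hm).trans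
    (Real.exp_le_exp.2 (neg_le_neg hmA)))
  have h2 := pow_mul_exp_neg_log_le d hn
  have h3 := hG.one_sub_ballMass_le (apply_nonneg (gaussNorm d n p) (castK d m - (n : ℝ) • p))
  have h4 := sqrt_two_pow_mul_exp_le d hn (hmA.trans (hellSq_le_gaussNorm_sq hn0 hp hm))
  have h5 := confSum_le_one (n := n) hp m
  have h6 := hG.ballMass_le_one (gaussNorm d n p (castK d m - (n : ℝ) • p))
  rw [abs_le]
  constructor <;> linarith

lemma abs_confSum_sub_ballMass_zero {n : ℕ} (hn : n ≠ 0) {p : Fin 0 → ℝ} (hp : p ∈ simplexInt 0)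
    (m : Fin 0 → ℕ) :
    |confSum 0 n p m - ballMass (gaussNorm 0 n p) (gaussConst 0 n p)
        (gaussNorm 0 n p (castK 0 m - (n : ℝ) • p))| = 0 := by
  have h1 : confSum 0 n p m = 1 := by
    rw [confSum_eq, filter_true_of_mem fun k _ => by rw [Subsingleton.elim k m],
      sum_multinomialPMF]
  have h2 : {z | gaussNorm 0 n p z ≤ gaussNorm 0 n p (castK 0 m - (n : ℝ) • p)} = Set.univ :=
    Set.eq_univ_of_forall fun z => by
      rw [Subsingleton.elim z (castK 0 m - (n : ℝ) • p)]
      exact le_refl (gaussNorm 0 n p (castK 0 m - (n : ℝ) • p))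
  rw [h1, ballMass, h2, setIntegral_univ, (isGaussianDensity_gaussNorm hn hp).integral_eq, sub_self,
    abs_zero]

/-- The error terms of the near regime in terms of the target bound. -/
lemma scale_bounds {τ D L s : ℝ} (hτ : 2 ≤ τ) (hD : 0 ≤ D) (hDτ : D ≤ τ) (hL : 1 ≤ L)
    (hs : 0 < s) :
    √2 * √τ / s * (√D * √L) ^ 3 ≤ 0.36 * (τ ^ 3 * D * (L * √L) / s) ∧
      √2 * √τ / s * D * (√D * √L) ^ 2 ≤ τ ^ 3 * D * (L * √L) / s / 2 := by
  have hτ0 : 0 < τ := by linarith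
  have hL0 : 0 ≤ L := by linarith
  have ht2 : √τ ^ 2 = τ := Real.sq_sqrt hτ0.le
  have hq2 : √D ^ 2 = D := Real.sq_sqrt hD
  have hl2 : √L ^ 2 = L := Real.sq_sqrt hL0
  have hl1 : 1 ≤ √L := Real.one_le_sqrt.2 hL
  have hr2 : √(2 : ℝ) ^ 2 = 2 := Real.sq_sqrt zero_le_two
  have hr1 : √(2 : ℝ) ≤ 1.42 := by
    rw [Real.sqrt_le_left (by norm_num)]
    norm_num
  have hR2 : (√D * √L) ^ 2 = D * L := by rw [mul_pow, hq2, hl2]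
  have hτ3 : 4 * τ ≤ τ ^ 3 := by
    have : (2 : ℝ) ^ 2 * τ ≤ τ ^ 2 * τ := by gcongr
    linarith
  have hτ23 : 2 * τ ^ 2 ≤ τ ^ 3 := by
    have : 2 * τ ^ 2 ≤ τ * τ ^ 2 := by gcongr
    linarith
  constructor
  · have h1 : √τ * √D ≤ τ := by
      calc √τ * √D ≤ √τ * √τ := by gcongr
        _ = τ := Real.mul_self_sqrt hτ0.le
    calc √2 * √τ / s * (√D * √L) ^ 3 = √2 * (√τ * √D) * (D * (L * √L)) / s := by
          rw [pow_succ, hR2]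
          ring
      _ ≤ 1.42 * (τ ^ 3 / 4) * (D * (L * √L)) / s := by
          gcongr
          linarith
      _ = 0.355 * (τ ^ 3 * D * (L * √L) / s) := by ring
      _ ≤ _ := by
          gcongr
          norm_num
  · have h1 : √2 * √τ ≤ τ := by
      refine le_of_sq_le_sq ?_ hτ0.le
      rw [mul_pow, hr2, ht2]
      nlinarith
    calc √2 * √τ / s * D * (√D * √L) ^ 2 = √2 * √τ * D * (D * (L * 1)) / s := by
          rw [hR2]
          ring
      _ ≤ τ * τ * (D * (L * √L)) / s := by gcongr
      _ ≤ τ ^ 3 / 2 * (D * (L * √L)) / s := by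
          gcongr
          linarith
      _ = _ := by ring

/-- Comparison of the exact highest-probability sum with its Gaussian integral analogue. -/
theorem stmt6 (d : ℕ) (τ : ℝ) (hτ : (d : ℝ) + 1 ≤ τ) (n : ℕ) (hn : τ ^ 4 ≤ (n : ℝ))
    (nh : Fin d → ℕ) (hpos : ∀ i, 0 < nh i) (hsum : ∑ i, nh i < n)
    (hphat : (fun i => (nh i : ℝ) / n) ∈ Ptau d τ)
    (p : Fin d → ℝ) (hp : p ∈ simplexInt d) :
    |confSum d n p nh -
        ∫ y in {y : Fin d → ℝ |
            gaussDens d p (delVec d n p (castK d nh)) ≤ gaussDens d p (delVec d n p y)},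
          (n : ℝ) ^ (-(d : ℝ) / 2) * gaussDens d p (delVec d n p y)| ≤
      194.96 * τ ^ 3 * ((d : ℝ) + 1) * Real.log n ^ ((3 : ℝ) / 2) / (n : ℝ) ^ ((1 : ℝ) / 2) := by
  have hn0 : n ≠ 0 := by omega
  have hn' : (0 : ℝ) < n := by positivity
  have hm : nh ∈ multSupport d n := mem_multSupport.2 hsum.le
  have hlog0 : 0 ≤ Real.log n := Real.log_natCast_nonneg n
  have hτ0 : 0 < τ := lt_of_lt_of_le (by positivity) hτ
  rw [setIntegral_gaussDens_eq hp]
  have hG := isGaussianDensity_gaussNorm hn0 hp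
  rcases eq_or_ne d 0 with rfl | hd
  · rw [abs_confSum_sub_ballMass_zero hn0 hp]
    positivity
  have hd1 : (1 : ℝ) ≤ d := by exact_mod_cast Nat.one_le_iff_ne_zero.2 hd
  have hτ2 : 2 ≤ τ := by linarith
  have hn16 : (16 : ℝ) ≤ n := by
    refine le_trans ?_ hn
    calc (16 : ℝ) = 2 ^ 4 := by norm_num
      _ ≤ τ ^ 4 := by gcongr
  have hn2 : 2 ≤ n := by
    have : (2 : ℝ) ≤ n := by linarith
    exact_mod_cast this
  have hL1 : 1 ≤ Real.log n := by
    rw [Real.le_log_iff_exp_le hn']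
    linarith [Real.exp_one_lt_d9]
  rw [← Real.sqrt_eq_rpow, show (3 : ℝ) / 2 = 1 + 1 / 2 by norm_num, Real.rpow_add (by linarith),
    Real.rpow_one, ← Real.sqrt_eq_rpow]
  set L := Real.log n
  have hl1 : 1 ≤ √L := Real.one_le_sqrt.2 hL1
  have hl2 : √L ^ 2 = L := Real.sq_sqrt hlog0
  set κ := τ ^ 3 * ((d : ℝ) + 1) * (L * √L) / √n with hκ
  have hrhs : 194.96 * τ ^ 3 * ((d : ℝ) + 1) * (L * √L) / √n = 194.96 * κ := by
    rw [hκ]; ring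
  rw [hrhs]
  have hsn : 0 < √(n : ℝ) := Real.sqrt_pos.2 hn'
  have hLl : 1 ≤ L * √L := one_le_mul_of_one_le_of_one_le hL1 hl1
  have hinv : 1 / √n ≤ κ := by
    rw [hκ]
    gcongr
    have h1 : (1 : ℝ) ≤ τ ^ 3 := one_le_pow₀ (by linarith)
    exact one_le_mul_of_one_le_of_one_le
      (one_le_mul_of_one_le_of_one_le h1 (by linarith)) hLl
  have hκ0 : 0 < κ := lt_of_lt_of_le (by positivity) hinv
  rcases le_total 1 (194.96 * κ) with hbig | hsmall
  · have h1 := confSum_nonneg (n := n) hp nh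
    have h2 := confSum_le_one (n := n) hp nh
    have h3 := hG.ballMass_nonneg (gaussNorm d n p (castK d nh - (n : ℝ) • p))
    have h4 := hG.ballMass_le_one (gaussNorm d n p (castK d nh - (n : ℝ) • p))
    rw [abs_le]
    constructor <;> linarith
  rcases le_total (2 * ((d + 1) * L)) (hellSq d n p nh) with hfar | hnear
  · refine (abs_confSum_sub_ballMass_le_of_lt_hellSq hn2 hp hm hfar).trans ?_
    linarith
  have hq1 : 1 ≤ √((d : ℝ) + 1) := Real.one_le_sqrt.2 (by linarith)
  have hq2 : √((d : ℝ) + 1) ^ 2 = d + 1 := Real.sq_sqrt (by positivity)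
  set q := √((d : ℝ) + 1)
  set R := q * √L with hR
  have hR2 : R ^ 2 = (d + 1) * L := by rw [hR, mul_pow, hq2, hl2]
  have hR1 : 1 ≤ R := one_le_mul_of_one_le_of_one_le hq1 hl1
  have ht2 : √τ ^ 2 = τ := Real.sq_sqrt hτ0.le
  have hr2 : √(2 : ℝ) ^ 2 = 2 := Real.sq_sqrt zero_le_two
  set u := √2 * √τ / √n with hu
  have hu0 : 0 < u := by positivity
  have hu2 : u ^ 2 = 2 * τ / n := by
    rw [hu, div_pow, mul_pow, hr2, ht2, Real.sq_sqrt hn'.le]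
  obtain ⟨hbound, hbound'⟩ := scale_bounds hτ2 (by positivity) hτ hL1 hsn
  have huR : 33 * (u * R ^ 3) ≤ 1 := by linarith
  have hmb := div_le_extK_of_mem_Ptau hτ0 hn0 hm hphat
  have hpu : ∀ i, 1 ≤ u ^ 2 * (n * extP d p i) := by
    have hA : hellSq d n p nh ≤ n / τ / 100 := by
      have h1 : u * R ≤ u * R ^ 3 := by
        gcongr
        exact le_self_pow₀ hR1 (by norm_num)
      have h2 : (u * R) ^ 2 ≤ (1 / 33) ^ 2 := by gcongr; linarith
      rw [mul_pow, hu2, hR2, div_mul_eq_mul_div, div_le_iff₀ hn'] at h2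
      refine hnear.trans ?_
      rw [le_div_iff₀ (by norm_num), le_div_iff₀ hτ0]
      nlinarith
    intro i
    have h := half_le_of_hellSq_le hp (by positivity) hmb hA i
    rw [hu2]
    calc (1 : ℝ) = 2 * τ / n * (n / τ / 2) := by field_simp
      _ ≤ _ := by gcongr
  have hdR : (d : ℝ) + 1 ≤ R ^ 2 := by
    rw [hR2]
    exact le_mul_of_one_le_right (by positivity) hL1
  have key := abs_confSum_sub_ballMass_le hd hp hn0 hu0 hpu hR1 hdR huR hm (by rwa [hR2])
  have htail := pow_mul_exp_neg_log_le d hn2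
  rw [← hR2] at htail
  refine key.trans ?_
  linarith
end
end

section
/- Let d ∈ ℕ, τ ≥ d+1, n ≥ τ⁴, and p ∈ P_τ. Let K ~ Multinomial(n,p) and U ~ Uniform(−1/2,1/2)^d be independent, and set X := K + U. Then | E[ log( φ_{Σ_p}(δ_{K,p}) / φ_{Σ_p}(δ_{X,p}) ) · 1_{{K ∈ B_{n,p}}} ] | ≤ τ (d+1) / (3n). In particular, log( φ_{Σ_p}(δ_{K,p}) / φ_{Σ_p}(δ_{X,p}) ) = (1/(2n)) (X−K)ᵀ Σ_p^{−1} (X−K) + (1/(2n)) [ (X−K)ᵀ Σ_p^{−1} (K − n p) + (K − n p)ᵀ Σ_p^{−1} (X−K) ]. -/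
open MeasureTheory Matrix Real Finset
open scoped BigOperators ENNReal NNReal

noncomputable section

/-- The Sherman–Morrison formula for `Σ_p⁻¹`. -/
lemma covM_inv {d : ℕ} {p : Fin d → ℝ} (hp : ∀ i, p i ≠ 0) (hs : 1 - ∑ i, p i ≠ 0) :
    (covM d p)⁻¹ =
      Matrix.of fun i j => (if i = j then (p i)⁻¹ else 0) + (1 - ∑ k, p k)⁻¹ := by
  apply Matrix.inv_eq_right_inv
  ext i j
  simp only [covM, Matrix.sub_apply, Matrix.mul_apply, Matrix.diagonal_apply,
    Matrix.vecMulVec_apply, Matrix.of_apply, Matrix.one_apply, mul_add, sub_mul, ite_mul,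
    zero_mul, mul_ite, mul_zero, Finset.sum_add_distrib, Finset.sum_sub_distrib,
    Finset.sum_ite_eq, Finset.sum_ite_eq', Finset.mem_univ, if_true]
  rw [← Finset.sum_mul, ← Finset.mul_sum]
  have hj := hp j
  by_cases h : i = j
  · subst h
    have := hp i
    simp only [if_true]
    field_simp
    ring
  · simp only [h, if_false]
    field_simp
    ring

lemma gaussDens_pos {d : ℕ} {p : Fin d → ℝ} (hp : p ∈ simplexInt d) (y : Fin d → ℝ) :
    0 < gaussDens d p y := by
  refine div_pos (Real.exp_pos _) (Real.sqrt_pos.2 (mul_pos (by positivity) ?_))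
  refine Finset.prod_pos fun i _ => ?_
  refine Fin.lastCases ?_ (fun i => ?_) i
  · simpa [extP] using hp.2
  · simpa [extP] using (hp.1 i).1

lemma log_gaussDens_div {d : ℕ} {p : Fin d → ℝ} (hp : p ∈ simplexInt d) (y z : Fin d → ℝ) :
    Real.log (gaussDens d p y / gaussDens d p z) =
      1 / 2 * (quadForm d p z - quadForm d p y) := by
  have h := gaussDens_pos hp y
  have h' := gaussDens_pos hp z
  have key : gaussDens d p y / gaussDens d p z =
      Real.exp (1 / 2 * (quadForm d p z - quadForm d p y)) := by
    rw [div_eq_iff h'.ne']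
    unfold gaussDens
    rw [← mul_div_assoc, ← Real.exp_add]
    congr 2
    ring
  rw [key, Real.log_exp]

lemma delVec_eq_smul (d n : ℕ) (p v : Fin d → ℝ) :
    delVec d n p v = (Real.sqrt n)⁻¹ • (v - (n : ℝ) • p) := by
  ext i
  simp [delVec, del, div_eq_inv_mul]

lemma quadForm_delVec (d n : ℕ) (p v : Fin d → ℝ) :
    quadForm d p (delVec d n p v) = (n : ℝ)⁻¹ * quadForm d p (v - (n : ℝ) • p) := by
  simp only [quadForm, delVec_eq_smul, Matrix.mulVec_smul, smul_dotProduct, dotProduct_smul,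
    smul_eq_mul, ← mul_assoc]
  rw [← mul_inv, Real.mul_self_sqrt (Nat.cast_nonneg n)]

lemma log_gaussDens_delVec_div {d : ℕ} (n : ℕ) {p : Fin d → ℝ} (hp : p ∈ simplexInt d)
    (k u : Fin d → ℝ) :
    Real.log (gaussDens d p (delVec d n p k) / gaussDens d p (delVec d n p (k + u))) =
      1 / (2 * (n : ℝ)) * (u ⬝ᵥ ((covM d p)⁻¹ *ᵥ u)) +
        1 / (2 * (n : ℝ)) * ((u ⬝ᵥ ((covM d p)⁻¹ *ᵥ (k - (n : ℝ) • p))) +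
          ((k - (n : ℝ) • p) ⬝ᵥ ((covM d p)⁻¹ *ᵥ u))) := by
  have h : k + u - (n : ℝ) • p = (k - (n : ℝ) • p) + u := by abel
  rw [log_gaussDens_div hp, quadForm_delVec, quadForm_delVec, h]
  simp only [quadForm, Matrix.mulVec_add, add_dotProduct, dotProduct_add, one_div, mul_inv]
  ring

section UniformBox

/-- The uniform law on `(-1/2, 1/2)`. -/
abbrev centeredUniform : Measure ℝ := volume.restrict (Set.Ioo (-(1 : ℝ) / 2) (1 / 2))

instance : IsProbabilityMeasure centeredUniform :=
  ⟨by rw [Measure.restrict_apply_univ, Real.volume_Ioo]; norm_num⟩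

lemma integral_centeredUniform : ∫ x, x ∂centeredUniform = 0 := by
  rw [← integral_Ioc_eq_integral_Ioo, ← intervalIntegral.integral_of_le (by norm_num), integral_id]
  norm_num

lemma uniformBoxLaw_eq_pi (d : ℕ) :
    uniformBoxLaw d = Measure.pi fun _ : Fin d => centeredUniform := by
  rw [uniformBoxLaw, volume_pi, Measure.restrict_pi_pi]

lemma integral_eval_uniformBoxLaw {d : ℕ} (i : Fin d) : ∫ x, x i ∂(uniformBoxLaw d) = 0 := by
  rw [uniformBoxLaw_eq_pi, integral_comp_eval (μ := fun _ : Fin d => centeredUniform)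
    (f := fun x : ℝ => x) aestronglyMeasurable_id, integral_centeredUniform]

lemma integral_eval_mul_eval_uniformBoxLaw {d : ℕ} {i j : Fin d} (hij : i ≠ j) :
    ∫ x, x i * x j ∂(uniformBoxLaw d) = 0 := by
  have h := (ProbabilityTheory.iIndepFun_pi (μ := fun _ : Fin d => centeredUniform)
    (X := fun _ x => x) fun _ => aemeasurable_id).indepFun hij
  have h0 := integral_eval_uniformBoxLaw i
  rw [uniformBoxLaw_eq_pi] at h0 ⊢
  rw [h.integral_fun_mul_eq_mul_integral (measurable_pi_apply i).aestronglyMeasurable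
    (measurable_pi_apply j).aestronglyMeasurable, h0, zero_mul]

lemma ae_abs_le_uniformBoxLaw (d : ℕ) : ∀ᵐ x ∂(uniformBoxLaw d), ∀ i, |x i| ≤ 1 / 2 := by
  filter_upwards [ae_restrict_mem (MeasurableSet.univ_pi fun _ => measurableSet_Ioo)] with x hx i
  have := hx i (Set.mem_univ i)
  rw [abs_le]
  constructor <;> linarith [this.1, this.2]

end UniformBox

lemma measurableSet_castK_image {d : ℕ} (s : Set (Fin d → ℕ)) : MeasurableSet (castK d '' s) :=
  (s.to_countable.image _).measurableSet

lemma abs_le_of_mem_castK_image_bulk {d n : ℕ} {τ : ℝ} {p x : Fin d → ℝ}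
    (hx : x ∈ castK d '' bulk d n τ p) (i : Fin d) : |x i| ≤ n := by
  obtain ⟨k, hk, rfl⟩ := hx
  have h : k i ≤ n :=
    (Finset.single_le_sum (fun j _ => Nat.zero_le (k j)) (Finset.mem_univ i)).trans hk.2.1.le
  simpa [castK] using h

/-- In the mean of `(Uᵀ A U + Uᵀ A (K - m) + (K - m)ᵀ A U) 1_S(K)` only the diagonal of `A`
contributes. -/
lemma integral_quadratic_mul_indicator {d : ℕ} {Ω : Type*} [MeasurableSpace Ω] {Pr : Measure Ω}
    [IsProbabilityMeasure Pr] {K U : Ω → Fin d → ℝ} (hKm : Measurable K) (hUm : Measurable U)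
    (hU : Measure.map U Pr = uniformBoxLaw d) (hind : ProbabilityTheory.IndepFun K U Pr)
    {S : Set (Fin d → ℝ)} (hS : MeasurableSet S) {M : ℝ} (hM : ∀ x ∈ S, ∀ i, |x i| ≤ M)
    (A : Matrix (Fin d) (Fin d) ℝ) (m : Fin d → ℝ) :
    ∫ ω, (U ω ⬝ᵥ (A *ᵥ U ω) + (U ω ⬝ᵥ (A *ᵥ (K ω - m)) + (K ω - m) ⬝ᵥ (A *ᵥ U ω))) *
        S.indicator (fun _ => (1 : ℝ)) (K ω) ∂Pr =
      (∑ i, A i i * ∫ ω, U ω i ^ 2 ∂Pr) * ∫ ω, S.indicator (fun _ => (1 : ℝ)) (K ω) ∂Pr := by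
  have hbd : ∀ᵐ ω ∂Pr, ∀ i, |U ω i| ≤ 1 / 2 :=
    ae_of_ae_map hUm.aemeasurable (hU ▸ ae_abs_le_uniformBoxLaw d)
  have hU1 (i : Fin d) : ∫ ω, U ω i ∂Pr = 0 := by
    rw [← integral_eval_uniformBoxLaw i, ← hU, integral_map hUm.aemeasurable
      (measurable_pi_apply i).aestronglyMeasurable]
  have hU2 {i j : Fin d} (hij : i ≠ j) : ∫ ω, U ω i * U ω j ∂Pr = 0 := by
    have hm : Measurable fun x : Fin d → ℝ => x i * x j := by fun_prop
    rw [← integral_eval_mul_eval_uniformBoxLaw hij, ← hU,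
      integral_map hUm.aemeasurable hm.aestronglyMeasurable]
  have hUi (i : Fin d) : Measurable fun ω => U ω i := (measurable_pi_apply i).comp hUm
  have hIU (i : Fin d) : Integrable (fun ω => U ω i) Pr :=
    Integrable.of_bound (hUi i).aestronglyMeasurable (1 / 2) (hbd.mono fun ω h => h i)
  have hIUU (i j : Fin d) : Integrable (fun ω => U ω i * U ω j) Pr :=
    (hIU i).mul_bdd (hUi j).aestronglyMeasurable (hbd.mono fun ω h => h j)
  set g : (Fin d → ℝ) → ℝ := S.indicator fun _ => (1 : ℝ) with hg
  have hgm : Measurable g := measurable_const.indicator hS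
  have hgI : Integrable (fun ω => g (K ω)) Pr := by
    refine Integrable.of_bound (hgm.comp hKm).aestronglyMeasurable 1 (.of_forall fun ω => ?_)
    by_cases h : K ω ∈ S <;> simp [hg, h]
  let c : Fin d → (Fin d → ℝ) → ℝ := fun i x => ∑ j, (A i j + A j i) * (x j - m j) * g x
  have hcm (i : Fin d) : Measurable (c i) := by fun_prop
  have hcI (i : Fin d) : Integrable (fun ω => c i (K ω)) Pr := by
    refine integrable_finsetSum _ fun j _ => ?_
    refine Integrable.of_bound (by fun_prop) (|A i j + A j i| * (|M| + |m j|))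
      (.of_forall fun ω => ?_)
    by_cases h : K ω ∈ S
    · simp only [hg, h, Set.indicator_of_mem, mul_one, Real.norm_eq_abs, abs_mul]
      exact mul_le_mul_of_nonneg_left ((abs_sub _ _).trans (by linarith [hM _ h j, le_abs_self M]))
        (abs_nonneg _)
    · simp only [hg, h, not_false_eq_true, Set.indicator_of_notMem, mul_zero, norm_zero]
      positivity
  have hexp (ω : Ω) :
      (U ω ⬝ᵥ (A *ᵥ U ω) + (U ω ⬝ᵥ (A *ᵥ (K ω - m)) + (K ω - m) ⬝ᵥ (A *ᵥ U ω))) * g (K ω) =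
        ∑ i, ∑ j, A i j * (U ω i * U ω j * g (K ω)) + ∑ i, U ω i * c i (K ω) := by
    have h : (K ω - m) ⬝ᵥ (A *ᵥ U ω) = U ω ⬝ᵥ (Aᵀ *ᵥ (K ω - m)) := by
      rw [Matrix.mulVec_transpose, Matrix.dotProduct_mulVec, dotProduct_comm]
    rw [h, ← dotProduct_add, ← Matrix.add_mulVec]
    simp only [dotProduct, Matrix.mulVec, add_mul, Finset.sum_mul, Finset.mul_sum, c,
      Matrix.add_apply, Matrix.transpose_apply, Pi.sub_apply]
    congr 1 <;> refine Finset.sum_congr rfl fun i _ => Finset.sum_congr rfl fun j _ => by ring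
  have hindUU (i j : Fin d) :
      ProbabilityTheory.IndepFun (fun ω => U ω i * U ω j) (fun ω => g (K ω)) Pr :=
    hind.symm.comp ((measurable_pi_apply i).mul (measurable_pi_apply j)) hgm
  have hindU (i : Fin d) :
      ProbabilityTheory.IndepFun (fun ω => U ω i) (fun ω => c i (K ω)) Pr :=
    hind.symm.comp (measurable_pi_apply i) (hcm i)
  have hI1 (i j : Fin d) : Integrable (fun ω => A i j * (U ω i * U ω j * g (K ω))) Pr :=
    ((hindUU i j).integrable_mul (hIUU i j) hgI).const_mul _
  have hI2 (i : Fin d) : Integrable (fun ω => U ω i * c i (K ω)) Pr :=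
    (hindU i).integrable_mul (hIU i) (hcI i)
  simp_rw [hexp]
  rw [integral_add (integrable_finsetSum _ fun i _ => integrable_finsetSum _ fun j _ => hI1 i j)
      (integrable_finsetSum _ fun i _ => hI2 i),
    integral_finsetSum _ fun i _ => integrable_finsetSum _ fun j _ => hI1 i j,
    integral_finsetSum _ fun i _ => hI2 i]
  have h2 (i : Fin d) : ∫ ω, U ω i * c i (K ω) ∂Pr = 0 := by
    rw [(hindU i).integral_fun_mul_eq_mul_integral (hIU i).1 (hcI i).1, hU1, zero_mul]
  rw [Finset.sum_eq_zero fun i _ => h2 i, add_zero, Finset.sum_mul]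
  refine Finset.sum_congr rfl fun i _ => ?_
  rw [integral_finsetSum _ fun j _ => hI1 i j, Finset.sum_eq_single i]
  · rw [integral_const_mul, (hindUU i i).integral_fun_mul_eq_mul_integral (hIUU i i).1 hgI.1,
      mul_assoc]
    simp only [sq]
  · intro j _ hj
    rw [integral_const_mul, (hindUU i j).integral_fun_mul_eq_mul_integral (hIUU i j).1 hgI.1,
      hU2 hj.symm, zero_mul, mul_zero]
  · simp

/-- **Bound on the term (II): comparison of the Gaussian log-densities at `δ_K` and `δ_X`.** -/
theorem stmt16 (d : ℕ) (τ : ℝ) (hτ : (d : ℝ) + 1 ≤ τ) (n : ℕ) (hn : τ ^ 4 ≤ (n : ℝ))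
    (p : Fin d → ℝ) (hp : p ∈ Ptau d τ)
    {Ω : Type*} [MeasurableSpace Ω] (Pr : Measure Ω) [IsProbabilityMeasure Pr]
    (K U : Ω → Fin d → ℝ) (hKm : Measurable K) (hUm : Measurable U)
    (hK : Measure.map K Pr = multinomialLaw d n p)
    (hU : Measure.map U Pr = uniformBoxLaw d)
    (hind : ProbabilityTheory.IndepFun K U Pr) :
    |∫ ω, Real.log (gaussDens d p (delVec d n p (K ω)) /
          gaussDens d p (delVec d n p (K ω + U ω))) *
        Set.indicator (castK d '' bulk d n τ p) (fun _ => (1 : ℝ)) (K ω) ∂Pr| ≤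
      τ * ((d : ℝ) + 1) / (3 * n) ∧
    ∀ ω : Ω,
      Real.log (gaussDens d p (delVec d n p (K ω)) /
          gaussDens d p (delVec d n p (K ω + U ω))) =
        1 / (2 * (n : ℝ)) *
            ((K ω + U ω - K ω) ⬝ᵥ ((covM d p)⁻¹ *ᵥ (K ω + U ω - K ω))) +
          1 / (2 * (n : ℝ)) *
            (((K ω + U ω - K ω) ⬝ᵥ ((covM d p)⁻¹ *ᵥ (K ω - (n : ℝ) • p))) +
              ((K ω - (n : ℝ) • p) ⬝ᵥ ((covM d p)⁻¹ *ᵥ (K ω + U ω - K ω)))) := by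
  have hs := hp.1
  have hpi (i : Fin d) : (p i)⁻¹ ≤ τ := by simpa [extP] using hp.2 i.castSucc
  have hpl : (1 - ∑ i, p i)⁻¹ ≤ τ := by simpa [extP] using hp.2 (Fin.last d)
  have hpl0 : 0 < 1 - ∑ i, p i := sub_pos.2 hs.2
  have hτ0 : 0 ≤ τ := (inv_pos.2 hpl0).le.trans hpl
  refine ⟨?_, fun ω => by rw [log_gaussDens_delVec_div n hs, add_sub_cancel_left]⟩
  have hA (i : Fin d) : (covM d p)⁻¹ i i = (p i)⁻¹ + (1 - ∑ k, p k)⁻¹ := by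
    simp [covM_inv (fun i => (hs.1 i).1.ne') hpl0.ne']
  have hbd : ∀ᵐ ω ∂Pr, ∀ i, |U ω i| ≤ 1 / 2 :=
    ae_of_ae_map hUm.aemeasurable (hU ▸ ae_abs_le_uniformBoxLaw d)
  have hsq (i : Fin d) : ∫ ω, U ω i ^ 2 ∂Pr ≤ 1 / 4 := by
    refine (integral_mono_of_nonneg (.of_forall fun ω => sq_nonneg _)
      (integrable_const (1 / 4)) ?_).trans_eq (by simp)
    filter_upwards [hbd] with ω h
    change U ω i ^ 2 ≤ 1 / 4
    rw [← sq_abs]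
    nlinarith [h i, abs_nonneg (U ω i)]
  have hsq0 (i : Fin d) : 0 ≤ ∫ ω, U ω i ^ 2 ∂Pr := integral_nonneg fun ω => sq_nonneg _
  set g : (Fin d → ℝ) → ℝ := (castK d '' bulk d n τ p).indicator fun _ => (1 : ℝ) with hg
  have hg0 (x : Fin d → ℝ) : 0 ≤ g x := Set.indicator_nonneg (fun _ _ => zero_le_one) x
  have hg1 (x : Fin d → ℝ) : g x ≤ 1 := Set.indicator_le_self' (fun _ _ => zero_le_one) x
  have hG0 : 0 ≤ ∫ ω, g (K ω) ∂Pr := integral_nonneg fun ω => hg0 _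
  have hG1 : ∫ ω, g (K ω) ∂Pr ≤ 1 :=
    (integral_mono_of_nonneg (.of_forall fun ω => hg0 _) (integrable_const 1)
      (.of_forall fun ω => hg1 _)).trans_eq (by simp)
  have hterm0 (i : Fin d) : 0 ≤ (covM d p)⁻¹ i i * ∫ ω, U ω i ^ 2 ∂Pr := by
    rw [hA]
    exact mul_nonneg (add_nonneg (inv_pos.2 (hs.1 i).1).le (inv_pos.2 hpl0).le) (hsq0 i)
  have hterm (i : Fin d) : (covM d p)⁻¹ i i * ∫ ω, U ω i ^ 2 ∂Pr ≤ 2 * τ * (1 / 4) := by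
    refine mul_le_mul ?_ (hsq i) (hsq0 i) (by positivity)
    rw [hA]
    linarith [hpi i]
  have hsum0 : 0 ≤ ∑ i, (covM d p)⁻¹ i i * ∫ ω, U ω i ^ 2 ∂Pr :=
    Finset.sum_nonneg fun i _ => hterm0 i
  have hsum : ∑ i, (covM d p)⁻¹ i i * ∫ ω, U ω i ^ 2 ∂Pr ≤ d * (2 * τ * (1 / 4)) :=
    (Finset.sum_le_sum fun i _ => hterm i).trans_eq (by simp)
  simp_rw [log_gaussDens_delVec_div n hs, ← mul_add, mul_assoc]
  rw [integral_const_mul, integral_quadratic_mul_indicator hKm hUm hU hind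
    (measurableSet_castK_image _) (fun x hx => abs_le_of_mem_castK_image_bulk hx),
    abs_of_nonneg (mul_nonneg (by positivity) (mul_nonneg hsum0 hG0))]
  calc 1 / (2 * (n : ℝ)) * ((∑ i, (covM d p)⁻¹ i i * ∫ ω, U ω i ^ 2 ∂Pr) * ∫ ω, g (K ω) ∂Pr)
      ≤ 1 / (2 * (n : ℝ)) * (d * (2 * τ * (1 / 4)) * 1) := by gcongr
    _ = τ * d / 4 * (n : ℝ)⁻¹ := by ring
    _ ≤ τ * (d + 1) / 3 * (n : ℝ)⁻¹ := by
        refine mul_le_mul_of_nonneg_right ?_ (by positivity)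
        have : 0 ≤ τ * d := by positivity
        linarith
    _ = τ * ((d : ℝ) + 1) / (3 * n) := by ring
end
end
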